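/- arXiv:2405.09419 — 4 statements merged into one kernel-verified Lean document; each statement's English description precedes it below -/
import Mathlib

section
/- Let ρ be the infimum over x ∈ K of ∑_{i=1}^N p_i(x)/q_i(x). Then ρ equals the supremum of c ∈ ℝ over all tuples (c, h_2, …, h_N) with h_i ∈ ℝ[x_1,…,x_n] such that p_1(x) + (∑_{i=2}^N h_i(x) − c)·q_1(x) ≥ 0 for all x ∈ K and p_i(x) − h_i(x)·q_i(x) ≥ 0 for all x ∈ K for each i = 2,…,N. (Equivalently, ρ = sup over polynomials h_i with h_i ≤ p_i/q_i on K (i = 2,…,N) of inf_{x∈K} p_1(x)/q_1(x) + ∑_{i=2}^N h_i(x).) -/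
open MvPolynomial

noncomputable section

/-- Weierstrass approximation: polynomials are uniformly dense in the functions continuous on a
compact subset of `ℝⁿ`. -/
theorem MvPolynomial.exists_eval_near_of_continuousOn {n : ℕ} {K : Set (Fin n → ℝ)}
    (hK : IsCompact K) {f : (Fin n → ℝ) → ℝ} (hf : ContinuousOn f K) {ε : ℝ} (hε : 0 < ε) :
    ∃ h : MvPolynomial (Fin n) ℝ, ∀ x ∈ K, |eval x h - f x| < ε := by
  have : CompactSpace K := isCompact_iff_compactSpace.mp hK
  let φ : MvPolynomial (Fin n) ℝ →ₐ[ℝ] C(K, ℝ) :=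
    aeval fun i => ⟨fun x => x.1 i, (continuous_apply i).comp continuous_subtype_val⟩
  have hφ (h : MvPolynomial (Fin n) ℝ) (x : K) : φ h x = eval x.1 h := by
    induction h using MvPolynomial.induction_on with
    | C a => simp [φ]
    | add a b ha hb => simp [ha, hb]
    | mul_X a i ha => simp [ha, φ]
  have hsep : φ.range.SeparatesPoints := by
    intro x y hxy
    obtain ⟨i, hi⟩ := Function.ne_iff.mp (Subtype.coe_ne_coe.mpr hxy)
    exact ⟨φ (X i), ⟨φ (X i), ⟨X i, rfl⟩, rfl⟩, by simpa [hφ] using hi⟩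
  obtain ⟨⟨_, h, rfl⟩, hh⟩ :=
    ContinuousMap.exists_mem_subalgebra_near_continuous_of_separatesPoints φ.range hsep
      (K.domRestrict f) hf.domRestrict ε hε
  exact ⟨h, fun x hx => by simpa [hφ, Set.domRestrict_apply] using hh ⟨x, hx⟩⟩

/-- One-sided uniform approximation of a continuous function from below by polynomials. -/
theorem MvPolynomial.exists_eval_le_of_continuousOn {n : ℕ} {K : Set (Fin n → ℝ)}
    (hK : IsCompact K) {f : (Fin n → ℝ) → ℝ} (hf : ContinuousOn f K) {ε : ℝ} (hε : 0 < ε) :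
    ∃ h : MvPolynomial (Fin n) ℝ, ∀ x ∈ K, f x - ε ≤ eval x h ∧ eval x h ≤ f x := by
  obtain ⟨h, hh⟩ := exists_eval_near_of_continuousOn hK
    (hf.sub (continuousOn_const (c := ε / 2))) (half_pos hε)
  refine ⟨h, fun x hx => ?_⟩
  have := abs_lt.mp (hh x hx)
  simp only [Pi.sub_apply] at this
  constructor <;> linarith

/-- (Theorem on the dual of the GMP reformulation.)
Let `K = {x ∈ ℝⁿ : g_j(x) ≥ 0, j = 1,…,m}` be compact and nonempty, with `q_i > 0` on `K`.
Then `ρ = inf_{x ∈ K} ∑_{i=1}^N p_i(x)/q_i(x)` equals the supremum of `c ∈ ℝ` over all tuples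
`(c, h_2, …, h_N)` of polynomials `h_i` such that
`p_1 + (∑_{i=2}^N h_i − c)·q_1 ≥ 0` on `K` and `p_i − h_i·q_i ≥ 0` on `K` for `i = 2,…,N`.
(Index `0 : Fin N` plays the role of the index `1` of the paper.) -/
theorem stmt_0 (n m N : ℕ) [NeZero N]
    (g : Fin m → MvPolynomial (Fin n) ℝ) (p q : Fin N → MvPolynomial (Fin n) ℝ)
    (K : Set (Fin n → ℝ)) (hKdef : K = {x | ∀ j, 0 ≤ eval x (g j)})
    (hK : IsCompact K) (hKne : K.Nonempty)
    (hq : ∀ i, ∀ x ∈ K, 0 < eval x (q i)) :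
    sInf {v : ℝ | ∃ x ∈ K, v = ∑ i, eval x (p i) / eval x (q i)} =
      sSup {c : ℝ | ∃ h : Fin N → MvPolynomial (Fin n) ℝ,
        (∀ x ∈ K, 0 ≤ eval x (p 0) +
          ((∑ i ∈ Finset.univ.erase (0 : Fin N), eval x (h i)) - c) * eval x (q 0)) ∧
        (∀ i : Fin N, i ≠ 0 → ∀ x ∈ K, 0 ≤ eval x (p i) - eval x (h i) * eval x (q i))} := by
  have hcont (i : Fin N) : ContinuousOn (fun x => eval x (p i) / eval x (q i)) K :=
    (continuous_eval (p i)).continuousOn.div (continuous_eval (q i)).continuousOn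
      fun x hx => (hq i x hx).ne'
  have hbdd : BddBelow {v : ℝ | ∃ x ∈ K, v = ∑ i, eval x (p i) / eval x (q i)} := by
    refine (hK.bddBelow_image (continuousOn_finsetSum Finset.univ fun i _ => hcont i)).mono ?_
    rintro _ ⟨x, hx, rfl⟩
    exact ⟨x, hx, rfl⟩
  set V := {v : ℝ | ∃ x ∈ K, v = ∑ i, eval x (p i) / eval x (q i)}
  set S := {c : ℝ | ∃ h : Fin N → MvPolynomial (Fin n) ℝ,
        (∀ x ∈ K, 0 ≤ eval x (p 0) +
          ((∑ i ∈ Finset.univ.erase (0 : Fin N), eval x (h i)) - c) * eval x (q 0)) ∧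
        (∀ i : Fin N, i ≠ 0 → ∀ x ∈ K, 0 ≤ eval x (p i) - eval x (h i) * eval x (q i))}
  have hVne : V.Nonempty := let ⟨x, hx⟩ := hKne; ⟨_, x, hx, rfl⟩
  have hsplit (x : Fin n → ℝ) : ∑ i, eval x (p i) / eval x (q i) =
      eval x (p 0) / eval x (q 0) +
        ∑ i ∈ Finset.univ.erase (0 : Fin N), eval x (p i) / eval x (q i) :=
    (Finset.add_sum_erase _ _ (Finset.mem_univ _)).symm
  -- weak duality
  have hweak : ∀ c ∈ S, c ≤ sInf V := by
    rintro c ⟨h, h0, hi⟩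
    refine le_csInf hVne ?_
    rintro _ ⟨x, hx, rfl⟩
    have hsum : ∑ i ∈ Finset.univ.erase (0 : Fin N), eval x (h i) ≤
        ∑ i ∈ Finset.univ.erase (0 : Fin N), eval x (p i) / eval x (q i) :=
      Finset.sum_le_sum fun i hmem => (le_div_iff₀ (hq i x hx)).mpr
        (sub_nonneg.mp (hi i (Finset.ne_of_mem_erase hmem) x hx))
    have hfirst : c - ∑ i ∈ Finset.univ.erase (0 : Fin N), eval x (h i) ≤
        eval x (p 0) / eval x (q 0) := by
      rw [le_div_iff₀ (hq 0 x hx)]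
      linarith [h0 x hx]
    linarith [hsplit x]
  -- every value below the infimum is feasible
  have hfeas (ε : ℝ) (hε : 0 < ε) : sInf V - ε ∈ S := by
    have hN : (0 : ℝ) < N := Nat.cast_pos.mpr (NeZero.pos N)
    choose h hh using fun i => exists_eval_le_of_continuousOn hK (hcont i) (div_pos hε hN)
    refine ⟨h, fun x hx => ?_, fun i _ x hx => ?_⟩
    · have hsum : ∑ i ∈ Finset.univ.erase (0 : Fin N),
          (eval x (p i) / eval x (q i) - eval x (h i)) ≤ ε :=
        calc _ ≤ ∑ i, (eval x (p i) / eval x (q i) - eval x (h i)) :=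
              Finset.sum_le_sum_of_subset_of_nonneg (Finset.erase_subset _ _)
                fun i _ _ => sub_nonneg.mpr (hh i x hx).2
          _ ≤ ∑ _i : Fin N, ε / N :=
              Finset.sum_le_sum fun i _ => by linarith [(hh i x hx).1]
          _ = ε := by simp [mul_div_cancel₀ _ hN.ne']
      rw [Finset.sum_sub_distrib] at hsum
      have hinf : sInf V ≤ ∑ i, eval x (p i) / eval x (q i) := csInf_le hbdd ⟨x, hx, rfl⟩
      rw [hsplit] at hinf
      have hfirst : (sInf V - ε) - ∑ i ∈ Finset.univ.erase (0 : Fin N), eval x (h i) ≤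
          eval x (p 0) / eval x (q 0) := by linarith
      rw [le_div_iff₀ (hq 0 x hx)] at hfirst
      linarith
    · exact sub_nonneg.mpr ((le_div_iff₀ (hq i x hx)).mp (hh i x hx).2)
  refine le_antisymm (le_of_forall_sub_le fun ε hε => ?_)
    (csSup_le ⟨_, hfeas 1 one_pos⟩ hweak)
  exact le_csSup ⟨_, hweak⟩ (hfeas ε hε)
end
end

section
/- Let K ⊆ ℝⁿ be compact and let p, q ∈ ℝ[x_1,…,x_n] with q(x) > 0 for all x ∈ K. Then there exists a constant c > 0 (depending on p, q and K) such that for every positive integer k there exists a polynomial h ∈ ℝ[x_1,…,x_n] of degree at most k with sup_{x ∈ K} |p(x)/q(x) − h(x)| ≤ c/k. -/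
open MvPolynomial

/-- A geometric sequence with ratio `1 - δ ∈ [0, 1)` decays at least like `1 / (δ (N + 1))`. -/
lemma one_sub_pow_mul_le_one {δ : ℝ} (h0 : 0 < δ) (h1 : δ ≤ 1) (N : ℕ) :
    (1 - δ) ^ N * (δ * (N + 1)) ≤ 1 := by
  have hpow : 0 ≤ (1 - δ) ^ N := pow_nonneg (by linarith) N
  have hb : 1 + (N : ℝ) * δ ≤ (1 + δ) ^ N := one_add_mul_le_pow (by linarith) N
  calc (1 - δ) ^ N * (δ * (N + 1)) ≤ (1 - δ) ^ N * (1 + δ) ^ N :=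
        mul_le_mul_of_nonneg_left (by linarith) hpow
    _ = (1 - δ ^ 2) ^ N := by rw [← mul_pow]; ring
    _ ≤ 1 := pow_le_one₀ (by nlinarith) (by nlinarith)

/-- The truncated geometric series `p * M⁻¹ * ∑_{j < N} (1 - q / M) ^ j` approximating `p / q`. -/
noncomputable def geomApprox {σ : Type*} (p q : MvPolynomial σ ℝ) (M : ℝ) (N : ℕ) :
    MvPolynomial σ ℝ :=
  ∑ j ∈ Finset.range N, p * (C M⁻¹ * (1 - C M⁻¹ * q) ^ j)

lemma totalDegree_geomApprox_le {σ : Type*} (p q : MvPolynomial σ ℝ) (M : ℝ) (N : ℕ) :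
    (geomApprox p q M N).totalDegree ≤ (p.totalDegree + q.totalDegree) * N := by
  refine totalDegree_finsetSum_le fun j hj => ?_
  have hjN : j + 1 ≤ N := Finset.mem_range.mp hj
  have hlin : (1 - C M⁻¹ * q).totalDegree ≤ q.totalDegree := by
    refine (totalDegree_sub _ _).trans (max_le (by simp) ?_)
    exact (totalDegree_mul _ _).trans (by simp)
  calc (p * (C M⁻¹ * (1 - C M⁻¹ * q) ^ j)).totalDegree
      ≤ p.totalDegree + ((C M⁻¹ : MvPolynomial σ ℝ).totalDegree
          + ((1 - C M⁻¹ * q) ^ j).totalDegree) :=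
        (totalDegree_mul _ _).trans (Nat.add_le_add_left (totalDegree_mul _ _) _)
    _ ≤ p.totalDegree + j * q.totalDegree := by
        rw [totalDegree_C, zero_add]
        exact Nat.add_le_add_left
          ((totalDegree_pow _ _).trans (Nat.mul_le_mul_left _ hlin)) _
    _ ≤ (p.totalDegree + q.totalDegree) * N := by nlinarith

lemma eval_div_sub_eval_geomApprox {σ : Type*} (p q : MvPolynomial σ ℝ) (M : ℝ) (N : ℕ)
    (x : σ → ℝ) (hq : eval x q ≠ 0) :
    eval x p / eval x q - eval x (geomApprox p q M N)
      = eval x p / eval x q * (1 - M⁻¹ * eval x q) ^ N := by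
  have hgeom := geom_sum_mul_neg (1 - M⁻¹ * eval x q) N
  simp only [geomApprox, map_sum, map_mul, map_pow, map_sub, map_one, eval_C, ← Finset.mul_sum]
  rw [show (1 - M⁻¹ * eval x q) ^ N
      = 1 - (∑ j ∈ Finset.range N, (1 - M⁻¹ * eval x q) ^ j) * (M⁻¹ * eval x q) by
    rw [sub_sub_cancel] at hgeom; linarith]
  field_simp

/-- Let `K ⊆ ℝⁿ` be compact and `p, q` real polynomials with `q > 0` on `K`.
Then there is a constant `c > 0` such that for every positive integer `k` there exists a
polynomial `h` of degree at most `k` with `sup_{x ∈ K} |p(x)/q(x) − h(x)| ≤ c/k`. -/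
theorem stmt_3 (n : ℕ) (K : Set (Fin n → ℝ)) (hK : IsCompact K)
    (p q : MvPolynomial (Fin n) ℝ) (hq : ∀ x ∈ K, 0 < eval x q) :
    ∃ c : ℝ, 0 < c ∧ ∀ k : ℕ, 0 < k → ∃ h : MvPolynomial (Fin n) ℝ,
      h.totalDegree ≤ k ∧ ∀ x ∈ K, |eval x p / eval x q - eval x h| ≤ c / k := by
  have hpc : ContinuousOn (fun x => eval x p) K := p.continuous_eval.continuousOn
  have hqc : ContinuousOn (fun x => eval x q) K := q.continuous_eval.continuousOn
  have hq0 : ∀ x ∈ K, eval x q ≠ 0 := fun x hx => (hq x hx).ne'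
  obtain ⟨B₀, hB₀⟩ := hK.exists_bound_of_continuousOn (hpc.div hqc hq0)
  obtain ⟨M₀, hM₀⟩ := hK.exists_bound_of_continuousOn hqc
  obtain ⟨L₀, hL₀⟩ := hK.exists_bound_of_continuousOn (hqc.inv₀ hq0)
  set B := max B₀ 1
  set M := max M₀ 1
  set L := max L₀ 1
  have hB1 : 1 ≤ B := le_max_right _ _
  have hM1 : 1 ≤ M := le_max_right _ _
  have hL1 : 1 ≤ L := le_max_right _ _
  set δ := M⁻¹ * L⁻¹
  have hδ0 : 0 < δ := by positivity
  have hδ1 : δ ≤ 1 := mul_le_one₀ (inv_le_one_of_one_le₀ hM1) (by positivity)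
    (inv_le_one_of_one_le₀ hL1)
  set D := p.totalDegree + q.totalDegree + 1
  refine ⟨B * D / δ, by positivity, fun k hk => ⟨geomApprox p q M (k / D), ?_, fun x hx => ?_⟩⟩
  · calc (geomApprox p q M (k / D)).totalDegree
        ≤ (p.totalDegree + q.totalDegree) * (k / D) := totalDegree_geomApprox_le p q M _
      _ ≤ D * (k / D) := Nat.mul_le_mul_right _ (Nat.le_succ _)
      _ ≤ k := Nat.mul_div_le k D
  · have hqx := hq x hx
    have hBx : |eval x p / eval x q| ≤ B := (hB₀ x hx).trans (le_max_left _ _)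
    have hMx : eval x q ≤ M := (le_abs_self _).trans ((hM₀ x hx).trans (le_max_left _ _))
    have hLx : (eval x q)⁻¹ ≤ L := (le_abs_self _).trans ((hL₀ x hx).trans (le_max_left _ _))
    have hlow : δ ≤ M⁻¹ * eval x q :=
      mul_le_mul_of_nonneg_left (inv_le_of_inv_le₀ hqx hLx) (by positivity)
    have hupp : M⁻¹ * eval x q ≤ 1 := inv_mul_le_one_of_le₀ hMx (by positivity)
    have hk' : (k : ℝ) ≤ D * ((k / D : ℕ) + 1) := by
      exact_mod_cast (Nat.lt_mul_div_succ k (Nat.succ_pos _)).le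
    have hdecay := one_sub_pow_mul_le_one hδ0 hδ1 (k / D)
    have hpow : 0 ≤ (1 - δ) ^ (k / D) := pow_nonneg (by linarith) _
    rw [eval_div_sub_eval_geomApprox p q M _ x hqx.ne', abs_mul,
      abs_of_nonneg (pow_nonneg (by linarith : 0 ≤ 1 - M⁻¹ * eval x q) _)]
    calc |eval x p / eval x q| * (1 - M⁻¹ * eval x q) ^ (k / D)
        ≤ B * (1 - δ) ^ (k / D) :=
          mul_le_mul hBx (pow_le_pow_left₀ (by linarith) (by linarith) _)
            (pow_nonneg (by linarith) _) (by positivity)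
      _ ≤ B * D / δ / k := by
          rw [le_div_iff₀ (by positivity), le_div_iff₀ hδ0]
          calc B * (1 - δ) ^ (k / D) * k * δ
              ≤ B * (1 - δ) ^ (k / D) * (D * ((k / D : ℕ) + 1)) * δ := by gcongr
            _ = B * D * ((1 - δ) ^ (k / D) * (δ * ((k / D : ℕ) + 1))) := by ring
            _ ≤ B * D := mul_le_of_le_one_right (by positivity) hdecay
end

section
/- Assume Q(g) is Archimedean and that the origin lies in the interior of K. Let q^max = max{q_i(x) : 2 ≤ i ≤ N, x ∈ K}, q^min = min{q_i(x) : 2 ≤ i ≤ N, x ∈ K}, ρ^max = max_{x∈K} ∑_{i=1}^N p_i(x)/q_i(x), κ = 1/sup{t > 0 : [−t, t]ⁿ ⊆ K}, and ω = max{1, κ}. Then there exist constants C_1 > 0 and C_2 > 0 (depending on the p_i's, q_i's, g_j's and K) such that, setting D(N,ε) = max{deg(p_i), ⌈4C_1(N−1)/ε⌉ + deg(q_i) : i = 1,…,N}, for every ε > 0 one has ρ_k ≥ ρ − ε whenever k ≥ C_2 · exp[(3·(3ωn)^{D(N,ε)}·D(N,ε)²·((4(ρ^max − ρ) + 3ε)(N−1)/ε)·(q^max/q^min))^{C_2}].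 -/
open MvPolynomial

noncomputable section

/-- A polynomial is a sum of squares. -/
def IsSOSPoly {n : ℕ} (σ : MvPolynomial (Fin n) ℝ) : Prop :=
  ∃ (t : ℕ) (f : Fin t → MvPolynomial (Fin n) ℝ), σ = ∑ i, f i ^ 2

/-- The `k`-th truncated quadratic module `Q_k(g)`. -/
def QMod {n m : ℕ} (g : Fin m → MvPolynomial (Fin n) ℝ) (k : ℕ) :
    Set (MvPolynomial (Fin n) ℝ) :=
  {f | ∃ (σ₀ : MvPolynomial (Fin n) ℝ) (σ : Fin m → MvPolynomial (Fin n) ℝ),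
    IsSOSPoly σ₀ ∧ (∀ j, IsSOSPoly (σ j)) ∧
    σ₀.totalDegree ≤ 2 * k ∧ (∀ j, (σ j * g j).totalDegree ≤ 2 * k) ∧
    f = σ₀ + ∑ j, σ j * g j}

/-- The quadratic module `Q(g) = ⋃_k Q_k(g)` is Archimedean. -/
def IsArchimedeanQM {n m : ℕ} (g : Fin m → MvPolynomial (Fin n) ℝ) : Prop :=
  ∃ M : ℝ, 0 < M ∧ ∃ k : ℕ, (C M - ∑ i, X i ^ 2) ∈ QMod g k

/-- `ρ_k`: optimal value of the order-`k` SOS relaxation (Dk).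
Index `0 : Fin N` plays the role of the index `1` of the paper. -/
def rhoRelax {n m N : ℕ} [NeZero N] (g : Fin m → MvPolynomial (Fin n) ℝ)
    (p q : Fin N → MvPolynomial (Fin n) ℝ) (k : ℕ) : ℝ :=
  sSup {c : ℝ | ∃ h : Fin N → MvPolynomial (Fin n) ℝ,
    (∀ i : Fin N, i ≠ 0 →
      (h i).totalDegree ≤ 2 * k - max (q 0).totalDegree (q i).totalDegree) ∧
    (p 0 + ((∑ i ∈ Finset.univ.erase (0 : Fin N), h i) - C c) * q 0) ∈ QMod g k ∧
    (∀ i : Fin N, i ≠ 0 → (p i - h i * q i) ∈ QMod g k)}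

/-- `ρ = inf_{x ∈ K} ∑_i p_i(x)/q_i(x)`. -/
def rhoVal {n N : ℕ} (K : Set (Fin n → ℝ))
    (p q : Fin N → MvPolynomial (Fin n) ℝ) : ℝ :=
  sInf {v : ℝ | ∃ x ∈ K, v = ∑ i, eval x (p i) / eval x (q i)}

/-- `ρ^max = max_{x ∈ K} ∑_i p_i(x)/q_i(x)`. -/
def rhoMaxVal {n N : ℕ} (K : Set (Fin n → ℝ))
    (p q : Fin N → MvPolynomial (Fin n) ℝ) : ℝ :=
  sSup {v : ℝ | ∃ x ∈ K, v = ∑ i, eval x (p i) / eval x (q i)}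

/-- `q^max = max{q_i(x) : 2 ≤ i ≤ N, x ∈ K}`. -/
def qMaxVal {n N : ℕ} [NeZero N] (K : Set (Fin n → ℝ))
    (q : Fin N → MvPolynomial (Fin n) ℝ) : ℝ :=
  sSup {v : ℝ | ∃ i : Fin N, i ≠ 0 ∧ ∃ x ∈ K, v = eval x (q i)}

/-- `q^min = min{q_i(x) : 2 ≤ i ≤ N, x ∈ K}`. -/
def qMinVal {n N : ℕ} [NeZero N] (K : Set (Fin n → ℝ))
    (q : Fin N → MvPolynomial (Fin n) ℝ) : ℝ :=
  sInf {v : ℝ | ∃ i : Fin N, i ≠ 0 ∧ ∃ x ∈ K, v = eval x (q i)}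

/-- `κ = 1 / sup{t > 0 : [−t,t]ⁿ ⊆ K}`. -/
def kappaVal {n : ℕ} (K : Set (Fin n → ℝ)) : ℝ :=
  1 / sSup {t : ℝ | 0 < t ∧ {x : Fin n → ℝ | ∀ i, |x i| ≤ t} ⊆ K}

/-- `D(N,ε) = max{deg p_i, ⌈4C₁(N−1)/ε⌉ + deg q_i : i = 1,…,N}`. -/
def DBound {n N : ℕ} (p q : Fin N → MvPolynomial (Fin n) ℝ) (C₁ ε : ℝ) : ℕ :=
  Finset.univ.sup fun i : Fin N =>
    max (p i).totalDegree (Nat.ceil (4 * C₁ * ((N : ℝ) - 1) / ε) + (q i).totalDegree)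

theorem hasDerivAt_eval_update {σ : Type*} [Fintype σ] [DecidableEq σ] (W : MvPolynomial σ ℝ)
    (x : σ → ℝ) (i : σ) :
    HasDerivAt (fun t : ℝ => eval (Function.update x i t) W) (eval x (pderiv i W)) (x i) := by
  induction W using MvPolynomial.induction_on with
  | C a => simpa using hasDerivAt_const (x i) a
  | add p q hp hq =>
    simp only [map_add]
    exact hp.add hq
  | mul_X p j hp =>
    have hX : HasDerivAt (fun t : ℝ => Function.update x i t j)
        (eval x (pderiv i (X j : MvPolynomial σ ℝ))) (x i) := by
      by_cases h : j = i
      · subst h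
        simp only [Function.update_self, pderiv_X_self, map_one]
        exact hasDerivAt_id (x j)
      · simpa [Function.update_of_ne h, pderiv_X_of_ne h] using hasDerivAt_const (x i) (x j)
    have := hp.mul hX
    simp only [Function.update_eq_self] at this
    simp only [map_mul, eval_X, pderiv_mul, map_add]
    exact this

/-- At a point minimising a real polynomial function all formal partial derivatives vanish. -/
theorem eval_pderiv_eq_zero_of_forall_le {σ : Type*} [Fintype σ] (W : MvPolynomial σ ℝ)
    (x : σ → ℝ) (h : ∀ y, eval x W ≤ eval y W) (i : σ) : eval x (pderiv i W) = 0 := by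
  classical
  refine IsLocalMin.hasDerivAt_eq_zero ?_ (hasDerivAt_eval_update W x i)
  refine Filter.Eventually.of_forall fun t => ?_
  simpa using h (Function.update x i t)

/-- If `W` is the sum of the powers `X i ^ (D + 1)` and a polynomial of degree at most `D`, then `W`
is integral modulo its partial derivatives. -/
theorem exists_monic_aeval_mem_span_pderiv {σ A : Type*} [Fintype σ] [CommRing A] [Algebra ℚ A]
    (D : ℕ) (V : MvPolynomial σ A) (hV : V.totalDegree ≤ D) :
    ∃ χ : Polynomial A, χ.Monic ∧
      Polynomial.aeval (∑ i, X i ^ (D + 1) + V) χ ∈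
        Ideal.span (Set.range fun i => pderiv i (∑ i, X i ^ (D + 1) + V)) := by
  classical
  set W := ∑ i, X i ^ (D + 1) + V with hW
  set I := Ideal.span (Set.range fun i => pderiv i W) with hI
  have hred : ∀ i, ∃ U : MvPolynomial σ A, (∀ s ∈ U.support, s.degree + 1 ≤ D) ∧
      X i ^ D - U ∈ I := by
    intro i
    refine ⟨- (C (algebraMap ℚ A (1 / (D + 1))) * pderiv i V), ?_, ?_⟩
    · intro s hs
      have h1 : coeff s (pderiv i V) ≠ 0 := by
        intro h0
        rw [mem_support_iff, coeff_neg, coeff_C_mul, h0] at hs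
        simp at hs
      rw [coeff_pderiv] at h1
      have h2 : s + Finsupp.single i 1 ∈ V.support := by
        rw [mem_support_iff]; intro h; simp [h] at h1
      have h3 := le_totalDegree h2
      have h4 : (s + Finsupp.single i 1).degree = s.degree + 1 := by
        simp
      have h5 : ((s + Finsupp.single i 1).sum fun _ e => e) = (s + Finsupp.single i 1).degree := by
        rfl
      omega
    · have h1 : pderiv i W = C ((D : A) + 1) * X i ^ D + pderiv i V := by
        rw [hW, map_add, map_sum]
        congr 1
        rw [Finset.sum_eq_single i]
        · simp
        · intro j _ hj
          simp [pderiv_X_of_ne hj]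
        · simp
      have h2 : X i ^ D - - (C (algebraMap ℚ A (1 / (D + 1))) * pderiv i V)
          = C (algebraMap ℚ A (1 / (D + 1))) * pderiv i W := by
        rw [h1, mul_add, ← mul_assoc, ← C_mul]
        have : algebraMap ℚ A (1 / (D + 1)) * ((D : A) + 1) = 1 := by
          have : ((D : A) + 1) = algebraMap ℚ A (D + 1) := by simp
          rw [this, ← map_mul, one_div, inv_mul_cancel₀ (by positivity), map_one]
        rw [this, C_1, one_mul, sub_neg_eq_add]
      rw [h2]
      exact I.mul_mem_left _ (Ideal.subset_span ⟨i, rfl⟩)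
  choose U hU hUI using hred
  let mk := Ideal.Quotient.mkₐ A I
  let S : Finset (σ →₀ ℕ) := (Finset.univ : Finset (σ → Fin (D + 1))).image
    fun a => Finsupp.equivFunOnFinite.symm fun i => (a i : ℕ)
  let N : Submodule A (MvPolynomial σ A ⧸ I) :=
    Submodule.span A (S.image fun s => mk (monomial s 1) : Finset _)
  have hmon : ∀ d : ℕ, ∀ s : σ →₀ ℕ, s.degree ≤ d → mk (monomial s 1) ∈ N := by
    intro d
    induction d using Nat.strong_induction_on with
    | _ d ih =>
    intro s hs
    by_cases hsm : ∀ i, s i < D + 1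
    · refine Submodule.subset_span ?_
      simp only [Finset.coe_image, Set.mem_image]
      refine ⟨s, ?_, rfl⟩
      simp only [S, Finset.coe_image, Set.mem_image]
      refine ⟨fun i => ⟨s i, hsm i⟩, by simp, ?_⟩
      ext i; simp
    · push Not at hsm
      obtain ⟨i, hi⟩ := hsm
      obtain ⟨r, hr⟩ : ∃ r, s = r + Finsupp.single i D := by
        refine ⟨s - Finsupp.single i D, ?_⟩
        ext j
        by_cases hj : i = j
        · subst hj; simp; omega
        · simp [hj]
      have hdeg : s.degree = r.degree + D := by rw [hr]; simp
      have h1 : mk (monomial s 1) = mk (monomial r 1 * U i) := by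
        have h2 : monomial s (1 : A) = monomial r 1 * X i ^ D := by
          rw [hr, X_pow_eq_monomial, monomial_mul, one_mul]
        have h3 : mk (X i ^ D) = mk (U i) := Ideal.Quotient.eq.2 (hUI i)
        rw [h2, map_mul, map_mul, h3]
      rw [h1, (U i).as_sum, Finset.mul_sum, map_sum]
      refine Submodule.sum_mem _ fun v hv => ?_
      have h4 : monomial r (1 : A) * monomial v (coeff v (U i)) =
          coeff v (U i) • monomial (r + v) 1 := by
        rw [monomial_mul, smul_monomial]; simp
      rw [h4, map_smul]
      refine Submodule.smul_mem _ _ (ih (r.degree + v.degree) ?_ _ (by simp))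
      have := hU i v hv
      omega
  have hfin : Module.Finite A (MvPolynomial σ A ⧸ I) := by
    refine ⟨⟨S.image fun s => mk (monomial s 1), ?_⟩⟩
    rw [eq_top_iff]
    intro b _
    obtain ⟨f, rfl⟩ := Ideal.Quotient.mkₐ_surjective A I b
    rw [f.as_sum, map_sum]
    refine Submodule.sum_mem _ fun v hv => ?_
    have h4 : monomial v (coeff v f) = coeff v f • monomial v (1 : A) := by
      rw [smul_monomial]; simp
    rw [h4, map_smul]
    exact Submodule.smul_mem _ _ (hmon _ v le_rfl)
  obtain ⟨χ, hχ, h0⟩ := (Algebra.IsIntegral.of_finite A (MvPolynomial σ A ⧸ I)).isIntegral (mk W)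
  refine ⟨χ, hχ, ?_⟩
  have h1 : mk (Polynomial.aeval W χ) = 0 := by
    rw [← Polynomial.aeval_algHom_apply]; exact h0
  exact Ideal.Quotient.eq_zero_iff_mem.1 h1

theorem coeff_coeff_map_C_mul_pow {R : Type*} [CommRing R] (f : Polynomial R) {b N M : ℕ}
    (h : b ≤ N) :
    ((f.map Polynomial.C * (Polynomial.X * Polynomial.C Polynomial.X) ^ b).coeff N).coeff M =
      if M = b then f.coeff (N - b) else 0 := by
  rw [mul_pow, ← Polynomial.C_pow, ← mul_assoc, Polynomial.coeff_mul_C,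
    Polynomial.coeff_mul_X_pow' (f.map Polynomial.C), if_pos h, Polynomial.coeff_map, Polynomial.coeff_C_mul,
    Polynomial.coeff_X_pow]
  simp

/-- The infimum of a family of nonnegative polynomials depending polynomially on a parameter `s`
satisfies a nontrivial polynomial equation with coefficients polynomial in `s`. -/
theorem exists_ne_zero_eval_isGLB_eq_zero {σ : Type*} [Fintype σ]
    (P : MvPolynomial σ (Polynomial ℝ)) :
    ∃ l : Polynomial (Polynomial ℝ), l ≠ 0 ∧ ∀ s v : ℝ,
      (∀ x : σ → ℝ, 0 ≤ eval₂Hom (Polynomial.evalRingHom s) x P) →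
      IsGLB (Set.range fun x : σ → ℝ => eval₂Hom (Polynomial.evalRingHom s) x P) v →
      l.eval₂ (Polynomial.evalRingHom s) v = 0 := by
  classical
  let V : MvPolynomial σ (Polynomial (Polynomial ℝ)) := C Polynomial.X * map Polynomial.C P
  set D := 2 * V.totalDegree + 1 with hD
  obtain ⟨χ, hχ, hmem⟩ := exists_monic_aeval_mem_span_pderiv D V (by omega)
  set W := ∑ i, X i ^ (D + 1) + V with hW
  let ev : ℝ → ℝ → Polynomial (Polynomial ℝ) →+* ℝ := fun s t =>
    Polynomial.eval₂RingHom (Polynomial.evalRingHom s) t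
  have hWe : ∀ s t x, eval x (map (ev s t) W) =
      ∑ i, x i ^ (D + 1) + t * eval₂Hom (Polynomial.evalRingHom s) x P := by
    intro s t x
    have h1 : (ev s t).comp Polynomial.C = Polynomial.evalRingHom s := by
      ext <;> simp [ev]
    simp only [hW, V, map_add, map_sum, map_pow, map_X, eval_X, map_mul, map_C, eval_C, map_map, h1]
    simp [ev, eval_map]
  have hroot : ∀ s t x, (∀ y, eval x (map (ev s t) W) ≤ eval y (map (ev s t) W)) →
      χ.eval₂ (ev s t) (eval x (map (ev s t) W)) = 0 := by
    intro s t x hx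
    let E : MvPolynomial σ (Polynomial (Polynomial ℝ)) →+* ℝ := (eval x).comp (map (ev s t))
    have hker : Ideal.span (Set.range fun i => pderiv i W) ≤ RingHom.ker E := by
      rw [Ideal.span_le]
      rintro _ ⟨i, rfl⟩
      have := eval_pderiv_eq_zero_of_forall_le _ x hx i
      rw [pderiv_map] at this
      exact this
    have h1 : E (Polynomial.aeval W χ) = 0 := hker hmem
    rw [Polynomial.aeval_def, Polynomial.hom_eval₂] at h1
    have h2 : E.comp (algebraMap _ (MvPolynomial σ (Polynomial (Polynomial ℝ)))) = ev s t := by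
      apply RingHom.ext
      intro a
      simp [E, algebraMap_eq]
    rw [h2] at h1
    exact h1
  let Ψ : Polynomial (Polynomial (Polynomial ℝ)) :=
    χ.eval₂ (Polynomial.mapRingHom Polynomial.C) (Polynomial.X * Polynomial.C Polynomial.X)
  have hΨ : Ψ ≠ 0 := by
    intro h0
    have h1 : (Ψ.coeff χ.natDegree).coeff χ.natDegree = 1 := by
      simp only [Ψ, Polynomial.eval₂_eq_sum_range, Polynomial.finsetSum_coeff,
        Polynomial.coe_mapRingHom]
      rw [Finset.sum_eq_single χ.natDegree]
      · rw [coeff_coeff_map_C_mul_pow _ le_rfl, if_pos rfl, hχ.coeff_natDegree]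
        simp
      · intro b hb hne
        have hb' : b ≤ χ.natDegree := by simpa [Nat.lt_succ_iff] using hb
        rw [coeff_coeff_map_C_mul_pow _ hb', if_neg (Ne.symm hne)]
      · intro h; simp at h
    rw [h0] at h1
    simp at h1
  refine ⟨Ψ.leadingCoeff, Polynomial.leadingCoeff_ne_zero.2 hΨ, ?_⟩
  intro s v hpos hv
  let PE : (σ → ℝ) → ℝ := fun x => eval₂Hom (Polynomial.evalRingHom s) x P
  have hsum : ∀ x : σ → ℝ, 0 ≤ ∑ i, x i ^ (D + 1) := fun x =>
    Finset.sum_nonneg fun i _ => Even.pow_nonneg ⟨V.totalDegree + 1, by omega⟩ _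
  have hmin : ∀ t : ℝ, 0 < t → ∃ x, ∀ y, eval x (map (ev s t) W) ≤ eval y (map (ev s t) W) := by
    intro t ht
    refine Continuous.exists_forall_le' (MvPolynomial.continuous_eval _) 0 ?_
    have hlarge : ∀ᶠ x : σ → ℝ in Filter.cocompact _, max 1 (eval 0 (map (ev s t) W)) ≤ ‖x‖ :=
      (tendsto_norm_cocompact_atTop).eventually_ge_atTop _
    filter_upwards [hlarge] with x hx
    have hx1 := (le_max_left _ _).trans hx
    have hx2 := (le_max_right _ _).trans hx
    refine hx2.trans ?_
    rw [hWe s t x]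
    have h3 : ‖x‖ ≤ ∑ i, x i ^ (D + 1) := by
      have hne : Nonempty σ := by
        by_contra h
        rw [not_nonempty_iff] at h
        have : ‖x‖ = 0 := by rw [Subsingleton.elim x 0, norm_zero]
        linarith
      obtain ⟨i, hi⟩ : ∃ i, ‖x‖ = |x i| := by
        obtain ⟨i, hi⟩ := Finite.exists_max fun i => ‖x i‖
        refine ⟨i, le_antisymm ?_ (norm_le_pi_norm x i)⟩
        exact (pi_norm_le_iff_of_nonneg (norm_nonneg _)).2 hi
      have hev : Even (D + 1) := ⟨V.totalDegree + 1, by omega⟩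
      calc ‖x‖ ≤ ‖x‖ ^ (D + 1) := le_self_pow₀ hx1 (by omega)
        _ = x i ^ (D + 1) := by rw [hi, hev.pow_abs]
        _ ≤ _ := Finset.single_le_sum (f := fun i => x i ^ (D + 1))
            (fun j _ => hev.pow_nonneg _) (Finset.mem_univ i)
    have := mul_nonneg ht.le (hpos x)
    linarith
  have hmin' : ∀ t : ℝ, ∃ x, 0 < t → ∀ y,
      eval x (map (ev s t) W) ≤ eval y (map (ev s t) W) := by
    intro t
    by_cases ht : 0 < t
    · obtain ⟨x, hx⟩ := hmin t ht
      exact ⟨x, fun _ => hx⟩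
    · exact ⟨0, fun h => absurd h ht⟩
  choose x hx using hmin'
  let τ : ℝ → ℝ := fun t => eval (x t) (map (ev s t) W) / t
  have hτlow : ∀ t, 0 < t → v ≤ τ t := by
    intro t ht
    rw [le_div_iff₀ ht, hWe]
    have h1 : v ≤ PE (x t) := hv.1 ⟨x t, rfl⟩
    have h2 := hsum (x t)
    have h3 := mul_le_mul_of_nonneg_left h1 ht.le
    simp only [PE] at h3
    linarith
  have hτup : ∀ y t, 0 < t → τ t ≤ PE y + (∑ i, y i ^ (D + 1)) * t⁻¹ := by
    intro y t ht
    rw [div_le_iff₀ ht]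
    refine (hx t ht y).trans (le_of_eq ?_)
    rw [hWe]
    field_simp
    ring
  have hτ : Filter.Tendsto τ Filter.atTop (nhds v) := by
    rw [tendsto_order]
    constructor
    · intro a ha
      filter_upwards [Filter.eventually_gt_atTop 0] with t ht
      exact ha.trans_le (hτlow t ht)
    · intro a ha
      obtain ⟨_, ⟨y, rfl⟩, hy⟩ := (isGLB_lt_iff hv).1 ha
      have hlim : Filter.Tendsto (fun t : ℝ => PE y + (∑ i, y i ^ (D + 1)) * t⁻¹) Filter.atTop
          (nhds (PE y + (∑ i, y i ^ (D + 1)) * 0)) :=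
        (tendsto_inv_atTop_zero.const_mul _).const_add _
      rw [mul_zero, add_zero] at hlim
      filter_upwards [Filter.eventually_gt_atTop 0, hlim.eventually_lt_const hy] with t ht h
      exact (hτup y t ht).trans_lt h
  let φ : ℝ → Polynomial (Polynomial ℝ) →+* ℝ := fun a =>
    Polynomial.eval₂RingHom (Polynomial.evalRingHom s) a
  have hφ : ∀ c, Continuous fun a => φ a c := by
    intro c
    have : ∀ a, φ a c = (c.map (Polynomial.evalRingHom s)).eval a := by
      intro a; simp [φ, Polynomial.eval_map]
    simp only [this]
    exact Polynomial.continuous _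
  have hzero : ∀ t, 0 < t → ∑ e ∈ Finset.range (Ψ.natDegree + 1), φ (τ t) (Ψ.coeff e) * t ^ e = 0 := by
    intro t ht
    rw [← Polynomial.eval₂_eq_sum_range]
    have h1 := hroot s t (x t) (hx t ht)
    have h2 : Polynomial.eval₂RingHom (φ (τ t)) t Ψ =
        χ.eval₂ (ev s t) (eval (x t) (map (ev s t) W)) := by
      simp only [Ψ]
      rw [Polynomial.hom_eval₂]
      congr 1
      · ext <;> simp [ev, φ]
      · simp [φ, τ]
        field_simp
    rw [← h1, ← h2]
    rfl
  have hlim : Filter.Tendsto (fun t : ℝ => ∑ e ∈ Finset.range (Ψ.natDegree + 1),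
      φ (τ t) (Ψ.coeff e) * (t⁻¹) ^ (Ψ.natDegree - e)) Filter.atTop
      (nhds (∑ e ∈ Finset.range (Ψ.natDegree + 1), φ v (Ψ.coeff e) * 0 ^ (Ψ.natDegree - e))) := by
    refine tendsto_finsetSum _ fun e _ => ?_
    exact (((hφ _).tendsto v).comp hτ).mul (tendsto_inv_atTop_zero.pow _)
  have hlim0 : Filter.Tendsto (fun t : ℝ => ∑ e ∈ Finset.range (Ψ.natDegree + 1),
      φ (τ t) (Ψ.coeff e) * (t⁻¹) ^ (Ψ.natDegree - e)) Filter.atTop (nhds 0) := by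
    refine tendsto_const_nhds.congr' ?_
    filter_upwards [Filter.eventually_gt_atTop 0] with t ht
    have h1 := congrArg (· * (t⁻¹) ^ Ψ.natDegree) (hzero t ht)
    simp only [zero_mul, Finset.sum_mul] at h1
    rw [← h1]
    refine Finset.sum_congr rfl fun e he => ?_
    have he' : e ≤ Ψ.natDegree := by simpa [Nat.lt_succ_iff] using he
    obtain ⟨c, hc⟩ := Nat.exists_eq_add_of_le he'
    rw [hc, Nat.add_sub_cancel_left, pow_add, mul_assoc, ← mul_assoc (t ^ e), ← mul_pow,
      mul_inv_cancel₀ ht.ne', one_pow, one_mul]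
  have hfin := tendsto_nhds_unique hlim hlim0
  rw [Finset.sum_range_succ, Finset.sum_eq_zero] at hfin
  · rwa [Nat.sub_self, pow_zero, mul_one, zero_add] at hfin
  · intro e he
    have : Ψ.natDegree - e ≠ 0 := by
      have := Finset.mem_range.1 he
      omega
    rw [zero_pow this, mul_zero]

theorem Polynomial.exists_mul_pow_le_abs_eval {b : Polynomial ℝ} (hb : b ≠ 0) :
    ∃ c > (0 : ℝ), ∃ k : ℕ, ∃ s₀ > (0 : ℝ), ∀ s, 0 < s → s ≤ s₀ → c * s ^ k ≤ |b.eval s| := by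
  obtain ⟨b', hb', hnd⟩ := Polynomial.exists_eq_pow_rootMultiplicity_mul_and_not_dvd b hb 0
  generalize b.rootMultiplicity 0 = k at hb'
  have h0 : b'.eval 0 ≠ 0 := by
    intro h
    exact hnd (Polynomial.dvd_iff_isRoot.2 h)
  have hlim : Filter.Tendsto (fun s => |b'.eval s|) (nhds 0) (nhds |b'.eval 0|) :=
    (b'.continuous.abs).tendsto 0
  have hev := hlim.eventually_const_lt (half_lt_self (abs_pos.2 h0))
  obtain ⟨s₀, hs₀, hball⟩ := Metric.eventually_nhds_iff.1 hev
  refine ⟨|b'.eval 0| / 2, by positivity, k, s₀ / 2, by positivity, ?_⟩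
  intro s hs hss
  have h1 := hball (y := s) (by rw [Real.dist_eq, sub_zero, abs_of_pos hs]; linarith)
  rw [hb', Polynomial.eval_mul, abs_mul]
  simp only [Polynomial.eval_pow, Polynomial.eval_sub, Polynomial.eval_X, Polynomial.eval_C,
    sub_zero, abs_pow, abs_of_pos hs]
  rw [mul_comm]
  gcongr

/-- Positive solutions `v` of a polynomial equation in `v`, with coefficients polynomial in `s`, are
bounded below by a power of `s`. -/
theorem exists_mul_pow_le_of_eval₂_eq_zero {l : Polynomial (Polynomial ℝ)} (hl : l ≠ 0) :
    ∃ c > (0 : ℝ), ∃ k : ℕ, ∃ s₀ > (0 : ℝ), ∀ s v, 0 < s → s ≤ s₀ → 0 < v →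
      l.eval₂ (Polynomial.evalRingHom s) v = 0 → c * s ^ k ≤ v := by
  obtain ⟨l', hl', hnd⟩ := Polynomial.exists_eq_pow_rootMultiplicity_mul_and_not_dvd l hl 0
  have h0 : l'.coeff 0 ≠ 0 := by
    intro h
    rw [Polynomial.coeff_zero_eq_eval_zero] at h
    exact hnd (Polynomial.dvd_iff_isRoot.2 h)
  obtain ⟨c, hc, k, s₀, hs₀, hlow⟩ := Polynomial.exists_mul_pow_le_abs_eval h0
  have hcont : Continuous fun z : ℝ × ℝ => l'.divX.eval₂ (Polynomial.evalRingHom z.1) z.2 := by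
    simp only [Polynomial.eval₂_eq_sum_range, Polynomial.coe_evalRingHom]
    refine continuous_finsetSum _ fun i _ => ?_
    exact ((Polynomial.continuous _).comp continuous_fst).mul (continuous_snd.pow _)
  obtain ⟨B, hB⟩ := ((isCompact_Icc (a := (0 : ℝ)) (b := 1)).prod
    (isCompact_Icc (a := (0 : ℝ)) (b := 1))).exists_bound_of_continuousOn hcont.continuousOn
  have hB' : 0 < |B| + 1 := by positivity
  refine ⟨min 1 (c / (|B| + 1)), by positivity, k, min 1 s₀, by positivity, ?_⟩
  intro s v hs hss hv hroot
  have hs1 : s ≤ 1 := hss.trans (min_le_left _ _)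
  have hpow : s ^ k ≤ 1 := pow_le_one₀ hs.le hs1
  by_cases hv1 : 1 ≤ v
  · calc min 1 (c / (|B| + 1)) * s ^ k ≤ 1 * 1 := by
          gcongr
          exact min_le_left _ _
      _ ≤ v := by linarith
  push Not at hv1
  have h1 : l'.eval₂ (Polynomial.evalRingHom s) v = 0 := by
    rw [hl', Polynomial.eval₂_mul] at hroot
    rcases mul_eq_zero.1 hroot with h | h
    · exfalso
      simp [Polynomial.eval₂_pow, hv.ne'] at h
    · exact h
  rw [← Polynomial.divX_mul_X_add l', Polynomial.eval₂_add, Polynomial.eval₂_mul,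
    Polynomial.eval₂_X, Polynomial.eval₂_C, Polynomial.coe_evalRingHom] at h1
  have h2 : |(l'.coeff 0).eval s| ≤ (|B| + 1) * v := by
    have h3 := hB (s, v) ⟨⟨hs.le, hs1⟩, ⟨hv.le, hv1.le⟩⟩
    rw [eq_neg_of_add_eq_zero_right h1, abs_neg, abs_mul, abs_of_pos hv]
    have h4 := le_abs_self B
    rw [Real.norm_eq_abs] at h3
    gcongr
    linarith
  have h5 := (hlow s hs (hss.trans (min_le_right _ _))).trans h2
  calc min 1 (c / (|B| + 1)) * s ^ k ≤ c / (|B| + 1) * s ^ k := by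
        gcongr
        exact min_le_right _ _
    _ = c * s ^ k / (|B| + 1) := by ring
    _ ≤ v := by
      rw [div_le_iff₀ hB']
      linarith

/-- A Łojasiewicz type inequality: if `f` is nonnegative on a basic closed semialgebraic set that is
contained in a ball because of one of its constraints, then `f x ≤ -s` forces a constraint to be
violated by at least a constant times a power of `s`. -/
theorem exists_eval_le_neg_of_ball {n : ℕ} {ι : Type*} [Fintype ι]
    (g : ι → MvPolynomial (Fin n) ℝ) (f : MvPolynomial (Fin n) ℝ) (j₀ : ι) (R : ℝ)
    (hj₀ : ∀ x, eval x (g j₀) = R - ∑ i, x i ^ 2)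
    (hf : ∀ x, (∀ j, 0 ≤ eval x (g j)) → 0 ≤ eval x f) :
    ∃ c > (0 : ℝ), ∃ k : ℕ, ∀ s, 0 < s → s ≤ 1 → ∀ x, eval x f ≤ -s →
      ∃ j, eval x (g j) ≤ -(c * s ^ k) := by
  classical
  let G : Option ι → MvPolynomial (Fin n) (Polynomial ℝ) := fun o =>
    o.elim (-(map Polynomial.C f + C Polynomial.X)) fun j => map Polynomial.C (g j)
  let Gr : ℝ → Option ι → (Fin n → ℝ) → ℝ := fun s o x =>
    o.elim (-(eval x f + s)) fun j => eval x (g j)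
  let P : MvPolynomial (Fin n ⊕ Option ι) (Polynomial ℝ) :=
    ∑ o, (rename Sum.inl (G o) - X (Sum.inr o) ^ 2) ^ 2
  let PE : ℝ → (Fin n ⊕ Option ι → ℝ) → ℝ := fun s z =>
    eval₂Hom (Polynomial.evalRingHom s) z P
  have hev : ∀ (s : ℝ) (h : MvPolynomial (Fin n) ℝ) (x : Fin n → ℝ),
      eval₂ (Polynomial.evalRingHom s) x (map Polynomial.C h) = eval x h := by
    intro s h x
    rw [eval₂_map]
    have : (Polynomial.evalRingHom s).comp Polynomial.C = RingHom.id ℝ := by ext; simp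
    rw [this]
    rfl
  have hGr : ∀ s o x, eval₂ (Polynomial.evalRingHom s) x (G o) = Gr s o x := by
    intro s o x
    cases o with
    | none =>
      have h1 := hev s f x
      simp only [G, Gr, Option.elim, ← coe_eval₂Hom, map_neg, map_add] at h1 ⊢
      rw [h1]
      simp
    | some j => exact hev s (g j) x
  have hPE : ∀ s z, PE s z = ∑ o, (Gr s o (z ∘ Sum.inl) - z (Sum.inr o) ^ 2) ^ 2 := by
    intro s z
    simp only [PE, P, map_sum, map_pow, map_sub, coe_eval₂Hom, eval₂_rename, hGr, eval₂_X]
  have hPE0 : ∀ s z, 0 ≤ PE s z := by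
    intro s z
    rw [hPE]
    positivity
  let φ : ℝ → (Fin n → ℝ) → ℝ := fun s x => ∑ o, (max 0 (-Gr s o x)) ^ 2
  have hφPE : ∀ s z, φ s (z ∘ Sum.inl) ≤ PE s z := by
    intro s z
    rw [hPE]
    refine Finset.sum_le_sum fun o _ => ?_
    rcases le_total 0 (-Gr s o (z ∘ Sum.inl)) with h | h
    · rw [max_eq_right h]
      nlinarith [sq_nonneg (z (Sum.inr o)), sq_nonneg (z (Sum.inr o) ^ 2)]
    · rw [max_eq_left h, zero_pow two_ne_zero]
      positivity
  have hPEφ : ∀ s x, ∃ z, PE s z = φ s x := by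
    intro s x
    refine ⟨Sum.elim x fun o => Real.sqrt (Gr s o x), ?_⟩
    rw [hPE]
    refine Finset.sum_congr rfl fun o _ => ?_
    simp only [Sum.elim_comp_inl, Sum.elim_inr]
    rcases le_total 0 (Gr s o x) with h | h
    · rw [Real.sq_sqrt h, max_eq_left (by linarith)]
      simp
    · rw [Real.sqrt_eq_zero_of_nonpos h, max_eq_right (by linarith)]
      ring
  have hφc : ∀ s, Continuous (φ s) := by
    intro s
    refine continuous_finsetSum _ fun o _ => ?_
    refine (continuous_const.max ?_).pow 2
    cases o with
    | none => exact (((MvPolynomial.continuous_eval f).add continuous_const).neg).neg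
    | some j => exact (MvPolynomial.continuous_eval (g j)).neg
  have hφpos : ∀ s, 0 < s → ∃ c > 0, ∀ x, c ≤ φ s x := by
    intro s hs
    have hpos : ∀ x, 0 < φ s x := by
      intro x
      have hterm : ∀ o, 0 < -Gr s o x → 0 < φ s x := fun o ho =>
        Finset.sum_pos' (fun _ _ => by positivity)
          ⟨o, Finset.mem_univ _, by rw [max_eq_right ho.le]; positivity⟩
      by_cases h : ∀ j, 0 ≤ eval x (g j)
      · refine hterm none ?_
        have := hf x h
        simp only [Gr, Option.elim]
        linarith
      · push Not at h
        obtain ⟨j, hj⟩ := h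
        refine hterm (some j) ?_
        simp only [Gr, Option.elim]
        linarith
    obtain ⟨x₀, -, hx₀⟩ := (isCompact_closedBall (0 : Fin n → ℝ) (|R| + 1)).exists_isMinOn
      ⟨0, by simp; positivity⟩ (hφc s).continuousOn
    refine ⟨min 1 (φ s x₀), lt_min one_pos (hpos x₀), fun x => ?_⟩
    by_cases hx : x ∈ Metric.closedBall (0 : Fin n → ℝ) (|R| + 1)
    · exact (min_le_right _ _).trans (hx₀ hx)
    · refine (min_le_left _ _).trans ?_
      have hR := le_abs_self R
      have hR0 := abs_nonneg R
      have h1 : ∃ i, |R| + 1 < |x i| := by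
        by_contra hcon
        push Not at hcon
        apply hx
        rw [mem_closedBall_zero_iff]
        exact (pi_norm_le_iff_of_nonneg (by positivity)).2 hcon
      obtain ⟨i, hi⟩ := h1
      have h2 : R + 1 ≤ ∑ i, x i ^ 2 := by
        calc R + 1 ≤ (|R| + 1) ^ 2 := by nlinarith
          _ ≤ |x i| ^ 2 := by gcongr
          _ = x i ^ 2 := sq_abs _
          _ ≤ _ := Finset.single_le_sum (f := fun i => x i ^ 2) (fun j _ => sq_nonneg _)
            (Finset.mem_univ i)
      calc (1 : ℝ) ≤ (max 0 (-Gr s (some j₀) x)) ^ 2 := by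
            have h3 : 1 ≤ -Gr s (some j₀) x := by
              simp only [Gr, Option.elim, hj₀]
              linarith
            rw [max_eq_right (by linarith)]
            nlinarith
        _ ≤ _ := Finset.single_le_sum (f := fun o => (max 0 (-Gr s o x)) ^ 2)
            (fun j _ => by positivity) (Finset.mem_univ _)
  obtain ⟨l, hl, hlroot⟩ := exists_ne_zero_eval_isGLB_eq_zero P
  obtain ⟨c, hc, k, s₀, hs₀, hlow⟩ := exists_mul_pow_le_of_eval₂_eq_zero hl
  have hφlow : ∀ s, 0 < s → s ≤ s₀ → ∀ x, c * s ^ k ≤ φ s x := by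
    intro s hs hss x
    obtain ⟨c', hc', hcφ⟩ := hφpos s hs
    have hne : (Set.range (PE s)).Nonempty := Set.range_nonempty _
    have hbdd : BddBelow (Set.range (PE s)) := ⟨0, by rintro _ ⟨z, rfl⟩; exact hPE0 s z⟩
    have hglb := isGLB_csInf hne hbdd
    have hv : 0 < sInf (Set.range (PE s)) := by
      refine hc'.trans_le (le_csInf hne ?_)
      rintro _ ⟨z, rfl⟩
      exact (hcφ _).trans (hφPE s z)
    have h1 := hlow s _ hs hss hv (hlroot s _ (hPE0 s) hglb)
    obtain ⟨z, hz⟩ := hPEφ s x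
    rw [← hz]
    exact h1.trans (hglb.1 ⟨z, rfl⟩)
  have hcard : (0 : ℝ) < Fintype.card ι := by
    exact_mod_cast Fintype.card_pos_iff.2 ⟨j₀⟩
  set s₁ := min 1 s₀ with hs₁
  have hs₁0 : 0 < s₁ := by positivity
  set c₁ := min 1 (c * s₁ ^ k / Fintype.card ι) with hc₁
  have hc₁0 : 0 < c₁ := by positivity
  refine ⟨c₁, hc₁0, k, ?_⟩
  intro s hs hs1 x hx
  set t := s * s₁ with ht
  have ht0 : 0 < t := by positivity
  have hts : t ≤ s := mul_le_of_le_one_right hs.le (min_le_left _ _)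
  have hts₀ : t ≤ s₀ := by
    calc t ≤ 1 * s₁ := by rw [ht]; gcongr
      _ ≤ s₀ := by rw [one_mul]; exact min_le_right _ _
  have h1 := hφlow t ht0 hts₀ x
  have h2 : φ t x = ∑ j, (max 0 (-eval x (g j))) ^ 2 := by
    simp only [φ, Fintype.sum_option, Gr, Option.elim]
    rw [max_eq_left (by linarith)]
    simp
  rw [h2] at h1
  by_contra hcon
  push Not at hcon
  have hpow : s ^ k ≤ 1 := pow_le_one₀ hs.le hs1
  have h3 : ∀ j, (max 0 (-eval x (g j))) ^ 2 < c * t ^ k / Fintype.card ι := by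
    intro j
    have hsk : 0 < s ^ k := by positivity
    have hm : max 0 (-eval x (g j)) < c₁ * s ^ k := by
      have := hcon j
      exact max_lt (by positivity) (by linarith)
    have hm0 : 0 ≤ max 0 (-eval x (g j)) := le_max_left _ _
    have hc1 : c₁ * s ^ k ≤ 1 := by
      have : c₁ ≤ 1 := min_le_left _ _
      nlinarith
    calc (max 0 (-eval x (g j))) ^ 2 ≤ max 0 (-eval x (g j)) := by nlinarith
      _ < c₁ * s ^ k := hm
      _ ≤ c * s₁ ^ k / Fintype.card ι * s ^ k := by
        gcongr
        exact min_le_right _ _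
      _ = c * t ^ k / Fintype.card ι := by rw [ht, mul_pow]; ring
  have h4 : ∑ j, (max 0 (-eval x (g j))) ^ 2 < ∑ _j : ι, c * t ^ k / Fintype.card ι :=
    Finset.sum_lt_sum_of_nonempty ⟨j₀, Finset.mem_univ _⟩ fun j _ => h3 j
  rw [Finset.sum_const, Finset.card_univ, nsmul_eq_mul, mul_div_cancel₀ _ hcard.ne'] at h4
  linarith

theorem exists_eval_le_neg_of_sum_sq_le {n m : ℕ} (g : Fin m → MvPolynomial (Fin n) ℝ)
    (f : MvPolynomial (Fin n) ℝ) (R : ℝ) (hf : ∀ x, (∀ j, 0 ≤ eval x (g j)) → 0 ≤ eval x f) :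
    ∃ c > (0 : ℝ), ∃ k : ℕ, ∀ s, 0 < s → s ≤ 1 → ∀ x, ∑ i, x i ^ 2 ≤ R → eval x f ≤ -s →
      ∃ j, eval x (g j) ≤ -(c * s ^ k) := by
  obtain ⟨c, hc, k, h⟩ := exists_eval_le_neg_of_ball
    (fun o : Option (Fin m) => o.elim (C R - ∑ i, X i ^ 2) g) f none R (by simp)
    (fun x hx => hf x fun j => hx (some j))
  refine ⟨c, hc, k, fun s hs hs1 x hxR hx => ?_⟩
  obtain ⟨j, hj⟩ := h s hs hs1 x hx
  cases j with
  | none =>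
    have : 0 < c * s ^ k := by positivity
    simp at hj
    linarith
  | some j => exact ⟨j, hj⟩

/-- The sum of the absolute values of the coefficients of a real polynomial. -/
def l1Norm {n : ℕ} (f : MvPolynomial (Fin n) ℝ) : ℝ :=
  ∑ s ∈ f.support, |coeff s f|

section L1Norm

variable {n : ℕ}

theorem l1Norm_eq_sum_of_support_subset (f : MvPolynomial (Fin n) ℝ) {S : Finset (Fin n →₀ ℕ)}
    (h : f.support ⊆ S) : l1Norm f = ∑ s ∈ S, |coeff s f| :=
  Finset.sum_subset h fun s _ hs => by rw [notMem_support_iff.1 hs, abs_zero]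

theorem l1Norm_nonneg (f : MvPolynomial (Fin n) ℝ) : 0 ≤ l1Norm f :=
  Finset.sum_nonneg fun _ _ => abs_nonneg _

theorem l1Norm_add_le (f h : MvPolynomial (Fin n) ℝ) : l1Norm (f + h) ≤ l1Norm f + l1Norm h := by
  classical
  rw [l1Norm_eq_sum_of_support_subset _ (support_add (p := f) (q := h)),
    l1Norm_eq_sum_of_support_subset f (Finset.subset_union_left (s₂ := h.support)),
    l1Norm_eq_sum_of_support_subset h (Finset.subset_union_right (s₁ := f.support)),
    ← Finset.sum_add_distrib]
  exact Finset.sum_le_sum fun s _ => by rw [coeff_add]; exact abs_add_le _ _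

theorem l1Norm_neg (f : MvPolynomial (Fin n) ℝ) : l1Norm (-f) = l1Norm f := by
  simp [l1Norm]

theorem l1Norm_sub_le (f h : MvPolynomial (Fin n) ℝ) : l1Norm (f - h) ≤ l1Norm f + l1Norm h := by
  rw [sub_eq_add_neg, ← l1Norm_neg h]
  exact l1Norm_add_le _ _

theorem l1Norm_monomial_le (s : Fin n →₀ ℕ) (c : ℝ) : l1Norm (monomial s c) ≤ |c| := by
  classical
  rw [l1Norm_eq_sum_of_support_subset _ (support_monomial_subset (s := s) (a := c))]
  simp

theorem l1Norm_C_le (c : ℝ) : l1Norm (C c : MvPolynomial (Fin n) ℝ) ≤ |c| :=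
  l1Norm_monomial_le 0 c

theorem l1Norm_sum_le {ι : Type*} (S : Finset ι) (f : ι → MvPolynomial (Fin n) ℝ) :
    l1Norm (∑ i ∈ S, f i) ≤ ∑ i ∈ S, l1Norm (f i) := by
  classical
  induction S using Finset.induction_on with
  | empty => simp [l1Norm]
  | insert a S ha ih =>
    rw [Finset.sum_insert ha, Finset.sum_insert ha]
    exact (l1Norm_add_le _ _).trans (by gcongr)

theorem l1Norm_mul_le (f h : MvPolynomial (Fin n) ℝ) : l1Norm (f * h) ≤ l1Norm f * l1Norm h := by
  have h1 : f * h = ∑ s ∈ f.support, ∑ t ∈ h.support,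
      monomial (s + t) (coeff s f * coeff t h) := by
    conv_lhs => rw [f.as_sum, h.as_sum, Finset.sum_mul_sum]
    simp only [monomial_mul]
  rw [h1]
  refine (l1Norm_sum_le _ _).trans ?_
  rw [l1Norm, l1Norm, Finset.sum_mul_sum]
  refine Finset.sum_le_sum fun s _ => (l1Norm_sum_le _ _).trans ?_
  exact Finset.sum_le_sum fun t _ => (l1Norm_monomial_le _ _).trans (abs_mul _ _).le

theorem l1Norm_pow_le (f : MvPolynomial (Fin n) ℝ) (k : ℕ) : l1Norm (f ^ k) ≤ l1Norm f ^ k := by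
  induction k with
  | zero => simpa using l1Norm_C_le (n := n) 1
  | succ k ih =>
    rw [pow_succ, pow_succ]
    exact (l1Norm_mul_le _ _).trans (mul_le_mul_of_nonneg_right ih (l1Norm_nonneg _))

theorem abs_eval_le_l1Norm (f : MvPolynomial (Fin n) ℝ) {x : Fin n → ℝ}
    (hx : ∀ i, x i ∈ Set.Icc (0 : ℝ) 1) : |eval x f| ≤ l1Norm f := by
  rw [eval_eq']
  refine (Finset.abs_sum_le_sum_abs _ _).trans (Finset.sum_le_sum fun s _ => ?_)
  rw [abs_mul]
  refine mul_le_of_le_one_right (abs_nonneg _) ?_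
  rw [abs_of_nonneg (Finset.prod_nonneg fun i _ => pow_nonneg (hx i).1 _)]
  exact Finset.prod_le_one (fun i _ => pow_nonneg (hx i).1 _)
    fun i _ => pow_le_one₀ (hx i).1 (hx i).2

end L1Norm

theorem abs_prod_sub_prod_le_sum {ι : Type*} (S : Finset ι) (a b : ι → ℝ)
    (ha : ∀ i ∈ S, a i ∈ Set.Icc (0 : ℝ) 1) (hb : ∀ i ∈ S, b i ∈ Set.Icc (0 : ℝ) 1) :
    |∏ i ∈ S, a i - ∏ i ∈ S, b i| ≤ ∑ i ∈ S, |a i - b i| := by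
  classical
  induction S using Finset.induction_on with
  | empty => simp
  | insert j S hj ih =>
    have ih' := ih (fun i hi => ha i (Finset.mem_insert_of_mem hi))
      (fun i hi => hb i (Finset.mem_insert_of_mem hi))
    obtain ⟨ha0, ha1⟩ := ha j (Finset.mem_insert_self _ _)
    have hB0 : 0 ≤ ∏ i ∈ S, b i :=
      Finset.prod_nonneg fun i hi => (hb i (Finset.mem_insert_of_mem hi)).1
    have hB1 : ∏ i ∈ S, b i ≤ 1 :=
      Finset.prod_le_one (fun i hi => (hb i (Finset.mem_insert_of_mem hi)).1)
        fun i hi => (hb i (Finset.mem_insert_of_mem hi)).2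
    rw [Finset.prod_insert hj, Finset.prod_insert hj, Finset.sum_insert hj]
    have h1 : a j * ∏ i ∈ S, a i - b j * ∏ i ∈ S, b i =
        (a j - b j) * ∏ i ∈ S, b i + a j * (∏ i ∈ S, a i - ∏ i ∈ S, b i) := by ring
    rw [h1]
    refine (abs_add_le _ _).trans (add_le_add ?_ ?_)
    · rw [abs_mul, abs_of_nonneg hB0]
      exact mul_le_of_le_one_right (abs_nonneg _) hB1
    · rw [abs_mul, abs_of_nonneg ha0]
      exact (mul_le_of_le_one_left (abs_nonneg _) ha1).trans ih'

/-- The Bernstein coefficients `ν.choose a / k.choose a` of `x ^ a` are close to the values of `x ^ a`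
at the grid points `ν / k`. -/
theorem abs_choose_div_choose_sub_pow_le {a k ν : ℕ} (hak : a ≤ k) (hν : ν ≤ k) :
    |(ν.choose a : ℝ) / k.choose a - ((ν : ℝ) / k) ^ a| ≤ (a : ℝ) ^ 2 / k := by
  rcases Nat.eq_zero_or_pos a with rfl | ha
  · simp
  have hk : (0 : ℝ) < k := by exact_mod_cast ha.trans_le hak
  have h1 : (ν.choose a : ℝ) / k.choose a =
      ∏ j ∈ Finset.range a, (((ν - j : ℕ) : ℝ) / ((k - j : ℕ) : ℝ)) := by
    have hfac : (a.factorial : ℝ) ≠ 0 := by positivity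
    rw [← mul_div_mul_left _ _ hfac, ← Nat.cast_mul, ← Nat.cast_mul,
      ← Nat.descFactorial_eq_factorial_mul_choose, ← Nat.descFactorial_eq_factorial_mul_choose,
      Nat.descFactorial_eq_prod_range, Nat.descFactorial_eq_prod_range, Nat.cast_prod,
      Nat.cast_prod, Finset.prod_div_distrib]
  have h2 : ((ν : ℝ) / k) ^ a = ∏ _j ∈ Finset.range a, ((ν : ℝ) / k) := by
    rw [Finset.prod_const, Finset.card_range]
  have hνk : (ν : ℝ) ≤ k := by exact_mod_cast hν
  rw [h1, h2]
  refine (abs_prod_sub_prod_le_sum _ _ _ ?_ ?_).trans ?_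
  · intro j _
    refine ⟨by positivity, div_le_one_of_le₀ ?_ (by positivity)⟩
    exact_mod_cast Nat.sub_le_sub_right hν j
  · intro j _
    exact ⟨by positivity, div_le_one_of_le₀ hνk hk.le⟩
  · have hterm : ∀ j ∈ Finset.range a,
        |((ν - j : ℕ) : ℝ) / ((k - j : ℕ) : ℝ) - (ν : ℝ) / k| ≤ (a : ℝ) / k := by
      intro j hj
      have hja : j < a := Finset.mem_range.1 hj
      have hjk : (j : ℝ) < k := by exact_mod_cast hja.trans_le hak
      have hja' : (j : ℝ) ≤ a := by exact_mod_cast hja.le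
      have hj0 : (0 : ℝ) ≤ j := by positivity
      have hν0 : (0 : ℝ) ≤ ν := by positivity
      have hkj : ((k - j : ℕ) : ℝ) = k - j := Nat.cast_sub (by omega)
      have hpos : (0 : ℝ) < k - j := by linarith
      rcases le_total j ν with h | h
      · have hjν : (j : ℝ) ≤ ν := by exact_mod_cast h
        rw [Nat.cast_sub h, hkj]
        have h3 : ((ν : ℝ) - j) / (k - j) - ν / k = -(j * (k - ν) / ((k - j) * k)) := by
          field_simp
          ring
        rw [h3, abs_neg, abs_of_nonneg (div_nonneg (mul_nonneg hj0 (by linarith)) (by positivity)),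
          div_le_div_iff₀ (by positivity) hk]
        have : (j : ℝ) * (k - ν) ≤ a * (k - j) := by
          apply mul_le_mul hja' (by linarith) (by linarith) (by linarith)
        nlinarith
      · have hjν : (ν : ℝ) ≤ j := by exact_mod_cast h
        rw [Nat.sub_eq_zero_of_le h, Nat.cast_zero, zero_div, zero_sub, abs_neg,
          abs_of_nonneg (by positivity)]
        gcongr
        linarith
    refine (Finset.sum_le_sum hterm).trans (le_of_eq ?_)
    rw [Finset.sum_const, Finset.card_range, nsmul_eq_mul]
    ring

theorem X_pow_eq_sum_bernstein {n : ℕ} (i : Fin n) {a k : ℕ} (h : a ≤ k) :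
    (X i : MvPolynomial (Fin n) ℝ) ^ a = ∑ ν ∈ Finset.range (k + 1),
      C ((ν.choose a : ℝ) / k.choose a * k.choose ν) * (X i ^ ν * (1 - X i) ^ (k - ν)) := by
  obtain ⟨d, rfl⟩ := Nat.exists_eq_add_of_le h
  rw [add_assoc, Finset.sum_range_add, Finset.sum_eq_zero, zero_add]
  · have h1 : (X i : MvPolynomial (Fin n) ℝ) ^ a = X i ^ a * (X i + (1 - X i)) ^ d := by simp
    conv_lhs => rw [h1, add_pow, Finset.mul_sum]
    refine Finset.sum_congr rfl fun j hj => ?_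
    have hjd : j ≤ d := by simpa [Nat.lt_succ_iff] using hj
    have hne : (((a + d).choose a : ℕ) : ℝ) ≠ 0 := by
      exact_mod_cast (Nat.choose_pos (by omega)).ne'
    have h2 : ((a + j).choose a : ℝ) / (a + d).choose a * (a + d).choose (a + j) = d.choose j := by
      have h3 := Nat.choose_mul (n := a + d) (k := a + j) (s := a) (by omega)
      rw [Nat.add_sub_cancel_left, Nat.add_sub_cancel_left] at h3
      rw [div_mul_eq_mul_div, div_eq_iff hne]
      have h4 : (((a + d).choose (a + j) * (a + j).choose a : ℕ) : ℝ) =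
        (((a + d).choose a * d.choose j : ℕ) : ℝ) := by rw [h3]
      push_cast at h4
      linarith
    rw [h2, Nat.add_sub_add_left, pow_add]
    simp only [map_natCast]
    ring
  · intro ν hν
    rw [Nat.choose_eq_zero_of_lt (Finset.mem_range.1 hν)]
    simp

/-- A polynomial that is at least `μ > 0` on the unit cube has nonnegative Bernstein coefficients
with respect to an explicitly bounded degree. -/
theorem exists_bernstein_coeff_nonneg {n : ℕ} (F : MvPolynomial (Fin n) ℝ) (μ : ℝ) {k : ℕ}
    (hk : 0 < k) (hdeg : F.totalDegree ≤ k)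
    (hlarge : l1Norm F * (F.totalDegree : ℝ) ^ 2 ≤ μ * k)
    (hF : ∀ x : Fin n → ℝ, (∀ i, x i ∈ Set.Icc (0 : ℝ) 1) → μ ≤ eval x F) :
    ∃ b : (Fin n → ℕ) → ℝ,
      (∀ ν ∈ Fintype.piFinset fun _ : Fin n => Finset.range (k + 1), 0 ≤ b ν) ∧
      F = ∑ ν ∈ Fintype.piFinset fun _ : Fin n => Finset.range (k + 1),
        C (b ν) * ∏ i, (X i ^ ν i * (1 - X i) ^ (k - ν i)) := by
  classical
  have hk' : (0 : ℝ) < k := by exact_mod_cast hk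
  have hs : ∀ s ∈ F.support, ∑ i, s i ≤ F.totalDegree := by
    intro s hs
    have := le_totalDegree hs
    rwa [Finsupp.sum_fintype _ _ (fun _ => rfl)] at this
  refine ⟨fun ν => (∑ s ∈ F.support, coeff s F * ∏ i, ((ν i).choose (s i) : ℝ) / k.choose (s i)) *
    ∏ i, (k.choose (ν i) : ℝ), ?_, ?_⟩
  · intro ν hν
    have hνk : ∀ i, ν i ≤ k := fun i => by
      have := Fintype.mem_piFinset.1 hν i
      simpa [Nat.lt_succ_iff] using this
    refine mul_nonneg ?_ (by positivity)
    have hx : ∀ i, (ν i : ℝ) / k ∈ Set.Icc (0 : ℝ) 1 := fun i =>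
      ⟨by positivity, div_le_one_of_le₀ (by exact_mod_cast hνk i) hk'.le⟩
    have h1 := hF (fun i => (ν i : ℝ) / k) hx
    have h2 : |(∑ s ∈ F.support, coeff s F * ∏ i, ((ν i).choose (s i) : ℝ) / k.choose (s i)) -
        eval (fun i => (ν i : ℝ) / k) F| ≤ l1Norm F * ((F.totalDegree : ℝ) ^ 2 / k) := by
      rw [eval_eq', ← Finset.sum_sub_distrib, l1Norm, Finset.sum_mul]
      refine (Finset.abs_sum_le_sum_abs _ _).trans (Finset.sum_le_sum fun s hsF => ?_)
      rw [← mul_sub, abs_mul]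
      refine mul_le_mul_of_nonneg_left ?_ (abs_nonneg _)
      have hsk : ∀ i, s i ≤ k := fun i =>
        ((Finset.single_le_sum (f := fun i => s i) (fun _ _ => Nat.zero_le _)
          (Finset.mem_univ i)).trans (hs s hsF)).trans hdeg
      refine (abs_prod_sub_prod_le_sum _ _ _ ?_ ?_).trans ?_
      · intro i _
        refine ⟨by positivity, div_le_one_of_le₀ ?_ (by positivity)⟩
        exact_mod_cast Nat.choose_le_choose _ (hνk i)
      · intro i _
        exact ⟨pow_nonneg (hx i).1 _, pow_le_one₀ (hx i).1 (hx i).2⟩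
      · refine (Finset.sum_le_sum fun i _ =>
          abs_choose_div_choose_sub_pow_le (hsk i) (hνk i)).trans ?_
        rw [← Finset.sum_div]
        gcongr
        have h3 : ∑ i, (s i) ^ 2 ≤ (∑ i, s i) ^ 2 := by
          rw [sq (∑ i, s i), Finset.sum_mul]
          refine Finset.sum_le_sum fun i _ => ?_
          rw [sq]
          exact Nat.mul_le_mul_left _ (Finset.single_le_sum (f := fun i => s i)
            (fun _ _ => Nat.zero_le _) (Finset.mem_univ i))
        have h4 : ∑ i, (s i) ^ 2 ≤ F.totalDegree ^ 2 :=
          h3.trans (Nat.pow_le_pow_left (hs s hsF) 2)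
        exact_mod_cast h4
    have h5 : l1Norm F * ((F.totalDegree : ℝ) ^ 2 / k) ≤ μ := by
      rw [← mul_div_assoc, div_le_iff₀ hk']
      exact hlarge
    have h6 := (abs_le.1 h2).1
    linarith
  · conv_lhs => rw [F.as_sum]
    simp only [Finset.sum_mul, map_sum]
    rw [Finset.sum_comm]
    refine Finset.sum_congr rfl fun s hsF => ?_
    have hsk : ∀ i, s i ≤ k := fun i =>
      ((Finset.single_le_sum (f := fun i => s i) (fun _ _ => Nat.zero_le _)
        (Finset.mem_univ i)).trans (hs s hsF)).trans hdeg
    have h1 : (monomial s (coeff s F) : MvPolynomial (Fin n) ℝ) =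
        C (coeff s F) * ∏ i, X i ^ s i := by
      rw [monomial_eq, Finsupp.prod_fintype _ _ (fun _ => pow_zero _)]
    rw [h1, Finset.prod_congr rfl fun i _ => X_pow_eq_sum_bernstein i (hsk i),
      Finset.prod_univ_sum, Finset.mul_sum]
    refine Finset.sum_congr rfl fun ν _ => ?_
    rw [Finset.prod_mul_distrib, ← map_prod, ← mul_assoc, ← C_mul, Finset.prod_mul_distrib,
      mul_assoc]

section QuadraticModule

variable {n m : ℕ} {g : Fin m → MvPolynomial (Fin n) ℝ}

theorem IsSOSPoly.zero : IsSOSPoly (0 : MvPolynomial (Fin n) ℝ) :=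
  ⟨0, Fin.elim0, by simp⟩

theorem IsSOSPoly.sq (f : MvPolynomial (Fin n) ℝ) : IsSOSPoly (f ^ 2) :=
  ⟨1, fun _ => f, by simp⟩

theorem IsSOSPoly.add {f h : MvPolynomial (Fin n) ℝ} (hf : IsSOSPoly f) (hh : IsSOSPoly h) :
    IsSOSPoly (f + h) := by
  obtain ⟨s, a, rfl⟩ := hf
  obtain ⟨t, b, rfl⟩ := hh
  refine ⟨s + t, Fin.append a b, ?_⟩
  rw [Fin.sum_univ_add]
  simp

theorem IsSOSPoly.sq_mul {f : MvPolynomial (Fin n) ℝ} (s : MvPolynomial (Fin n) ℝ)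
    (hf : IsSOSPoly f) : IsSOSPoly (s ^ 2 * f) := by
  obtain ⟨t, a, rfl⟩ := hf
  exact ⟨t, fun i => s * a i, by simp [mul_pow, Finset.mul_sum]⟩

theorem IsSOSPoly.eval_nonneg {f : MvPolynomial (Fin n) ℝ} (hf : IsSOSPoly f) (x : Fin n → ℝ) :
    0 ≤ eval x f := by
  obtain ⟨t, a, rfl⟩ := hf
  rw [map_sum]
  exact Finset.sum_nonneg fun i _ => by rw [map_pow]; exact sq_nonneg _

theorem QMod.eval_nonneg {k : ℕ} {f : MvPolynomial (Fin n) ℝ} (hf : f ∈ QMod g k)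
    {x : Fin n → ℝ} (hx : ∀ j, 0 ≤ eval x (g j)) : 0 ≤ eval x f := by
  obtain ⟨σ₀, σ, h0, hσ, -, -, rfl⟩ := hf
  rw [map_add, map_sum]
  refine add_nonneg (h0.eval_nonneg x) (Finset.sum_nonneg fun j _ => ?_)
  rw [map_mul]
  exact mul_nonneg ((hσ j).eval_nonneg x) (hx j)

theorem QMod.mono {k l : ℕ} (hkl : k ≤ l) : QMod g k ⊆ QMod g l := by
  rintro f ⟨σ₀, σ, h0, hσ, hd0, hd, rfl⟩
  exact ⟨σ₀, σ, h0, hσ, by omega, fun j => (hd j).trans (by omega), rfl⟩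

theorem QMod.zero_mem (k : ℕ) : (0 : MvPolynomial (Fin n) ℝ) ∈ QMod g k :=
  ⟨0, fun _ => 0, .zero, fun _ => .zero, by simp, by simp, by simp⟩

theorem QMod.add_mem {k : ℕ} {f h : MvPolynomial (Fin n) ℝ} (hf : f ∈ QMod g k)
    (hh : h ∈ QMod g k) : f + h ∈ QMod g k := by
  obtain ⟨σ₀, σ, h0, hσ, hd0, hd, rfl⟩ := hf
  obtain ⟨τ₀, τ, h0', hτ, hd0', hd', rfl⟩ := hh
  refine ⟨σ₀ + τ₀, fun j => σ j + τ j, h0.add h0', fun j => (hσ j).add (hτ j),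
    (totalDegree_add _ _).trans (max_le hd0 hd0'), fun j => ?_, ?_⟩
  · rw [add_mul]
    exact (totalDegree_add _ _).trans (max_le (hd j) (hd' j))
  · simp only [add_mul, Finset.sum_add_distrib]
    ring

theorem QMod.sum_mem {k : ℕ} {ι : Type*} (S : Finset ι) (f : ι → MvPolynomial (Fin n) ℝ)
    (hf : ∀ i ∈ S, f i ∈ QMod g k) : ∑ i ∈ S, f i ∈ QMod g k := by
  classical
  induction S using Finset.induction_on with
  | empty => exact QMod.zero_mem k
  | insert a S ha ih =>
    rw [Finset.sum_insert ha]
    exact QMod.add_mem (hf a (Finset.mem_insert_self _ _))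
      (ih fun i hi => hf i (Finset.mem_insert_of_mem hi))

theorem QMod.sq_mul_mem {k l : ℕ} {f s : MvPolynomial (Fin n) ℝ} (hf : f ∈ QMod g k)
    (hs : s.totalDegree ≤ l) : s ^ 2 * f ∈ QMod g (k + l) := by
  obtain ⟨σ₀, σ, h0, hσ, hd0, hd, rfl⟩ := hf
  have hs2 : (s ^ 2).totalDegree ≤ 2 * l :=
    (totalDegree_pow _ _).trans (Nat.mul_le_mul_left _ hs)
  refine ⟨s ^ 2 * σ₀, fun j => s ^ 2 * σ j, h0.sq_mul s, fun j => (hσ j).sq_mul s,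
    (totalDegree_mul _ _).trans (by omega), fun j => ?_, ?_⟩
  · rw [mul_assoc]
    have := hd j
    exact (totalDegree_mul _ _).trans (by omega)
  · rw [mul_add, Finset.mul_sum]
    simp only [mul_assoc]

theorem QMod.C_mul_mem {k : ℕ} {f : MvPolynomial (Fin n) ℝ} (hf : f ∈ QMod g k) {c : ℝ}
    (hc : 0 ≤ c) : C c * f ∈ QMod g k := by
  have := QMod.sq_mul_mem (l := 0) hf (s := C (Real.sqrt c)) (by simp)
  rwa [← map_pow, Real.sq_sqrt hc] at this

theorem QMod.one_mem (k : ℕ) : (1 : MvPolynomial (Fin n) ℝ) ∈ QMod g k :=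
  ⟨1, fun _ => 0, by simpa using IsSOSPoly.sq (1 : MvPolynomial (Fin n) ℝ), fun _ => .zero,
    by simp, by simp, by simp⟩

theorem QMod.sq_mem {k : ℕ} {s : MvPolynomial (Fin n) ℝ} (hs : s.totalDegree ≤ k) :
    s ^ 2 ∈ QMod g k := by
  simpa using QMod.sq_mul_mem (QMod.one_mem (g := g) 0) hs

theorem QMod.generator_mem {k : ℕ} (j : Fin m) (hj : (g j).totalDegree ≤ 2 * k) :
    g j ∈ QMod g k := by
  classical
  refine ⟨0, Pi.single j 1, .zero, fun i => ?_, by simp, fun i => ?_, ?_⟩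
  · by_cases h : i = j
    · subst h
      simpa using IsSOSPoly.sq (1 : MvPolynomial (Fin n) ℝ)
    · simpa [h] using IsSOSPoly.zero
  · by_cases h : i = j
    · subst h
      simpa using hj
    · simp [h]
  · simp [Pi.single_apply]

/-- If `1 - ∑ yᵢ²` lies in the quadratic module, so do all products of the `1 - yᵢ²`. -/
theorem exists_prod_one_sub_sq_mem {k₀ : ℕ} (y : Fin n → MvPolynomial (Fin n) ℝ)
    (hy : 1 - ∑ i, y i ^ 2 ∈ QMod g k₀) :
    ∃ k₁, ∀ S : Finset (Fin n), ∏ i ∈ S, (1 - y i ^ 2) ∈ QMod g k₁ := by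
  classical
  have key : ∀ S : Finset (Fin n), ∃ k, ∏ i ∈ S, (1 - y i ^ 2) ∈ QMod g k ∧
      1 - ∏ i ∈ S, (1 - y i ^ 2) ∈ QMod g k ∧
      ∏ i ∈ S, (1 - y i ^ 2) - (1 - ∑ i ∈ S, y i ^ 2) ∈ QMod g k := by
    intro S
    induction S using Finset.induction_on with
    | empty => exact ⟨0, by simpa using QMod.one_mem 0, by simpa using QMod.zero_mem 0,
        by simpa using QMod.zero_mem 0⟩
    | insert a S ha ih =>
      obtain ⟨k, h1, h2, h3⟩ := ih
      set P := ∏ i ∈ S, (1 - y i ^ 2) with hP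
      have e3 : (1 - y a ^ 2) * P - (1 - (y a ^ 2 + ∑ i ∈ S, y i ^ 2)) =
          (P - (1 - ∑ i ∈ S, y i ^ 2)) + y a ^ 2 * (1 - P) := by ring
      have e2 : 1 - (1 - y a ^ 2) * P = (1 - P) + y a ^ 2 * P := by ring
      set l := (y a).totalDegree with hl
      have m3 : (1 - y a ^ 2) * P - (1 - (y a ^ 2 + ∑ i ∈ S, y i ^ 2)) ∈ QMod g (k + l) := by
        rw [e3]
        exact QMod.add_mem (QMod.mono (by omega) h3) (QMod.sq_mul_mem h2 le_rfl)
      have m2 : 1 - (1 - y a ^ 2) * P ∈ QMod g (k + l) := by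
        rw [e2]
        exact QMod.add_mem (QMod.mono (by omega) h2) (QMod.sq_mul_mem h1 le_rfl)
      have e1 : (1 - y a ^ 2) * P =
          ((1 - y a ^ 2) * P - (1 - (y a ^ 2 + ∑ i ∈ S, y i ^ 2))) +
          ((1 - ∑ i, y i ^ 2) + ∑ i ∈ (insert a S)ᶜ, y i ^ 2) := by
        rw [← Finset.sum_add_sum_compl (insert a S) fun i => y i ^ 2, Finset.sum_insert ha]
        ring
      have m1 : (1 - y a ^ 2) * P ∈ QMod g (k + l + k₀ + ∑ i, (y i).totalDegree) := by
        rw [e1]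
        refine QMod.add_mem (QMod.mono (by omega) m3) (QMod.add_mem (QMod.mono (by omega) hy) ?_)
        refine QMod.sum_mem _ _ fun i _ => QMod.sq_mem ?_
        exact (Finset.single_le_sum (f := fun i => (y i).totalDegree)
          (fun _ _ => Nat.zero_le _) (Finset.mem_univ i)).trans (by omega)
      refine ⟨k + l + k₀ + ∑ i, (y i).totalDegree, ?_, ?_, ?_⟩
      · rwa [Finset.prod_insert ha]
      · rw [Finset.prod_insert ha]
        exact QMod.mono (by omega) m2
      · rw [Finset.prod_insert ha, Finset.sum_insert ha]
        exact QMod.mono (by omega) m3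
  choose κ hκ using key
  exact ⟨∑ S, κ S, fun S => QMod.mono (Finset.single_le_sum (f := κ)
    (fun _ _ => Nat.zero_le _) (Finset.mem_univ S)) (hκ S).1⟩

/-- The affine substitution mapping the cube `[-R, R]ⁿ` onto the unit cube. -/
def toUnitCube (R : ℝ) (i : Fin n) : MvPolynomial (Fin n) ℝ :=
  C (1 / 2) * (1 + C (1 / R) * X i)

/-- The affine substitution mapping the unit cube onto the cube `[-R, R]ⁿ`. -/
def ofUnitCube (R : ℝ) (i : Fin n) : MvPolynomial (Fin n) ℝ :=
  C R * (2 * X i - 1)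

theorem totalDegree_toUnitCube_le (R : ℝ) (i : Fin n) : (toUnitCube R i).totalDegree ≤ 1 := by
  refine (totalDegree_mul _ _).trans ?_
  rw [totalDegree_C, zero_add]
  refine (totalDegree_add _ _).trans (max_le (by simp) ?_)
  exact (totalDegree_mul _ _).trans (by simp)

theorem totalDegree_ofUnitCube_le (R : ℝ) (i : Fin n) : (ofUnitCube R i).totalDegree ≤ 1 := by
  refine (totalDegree_mul _ _).trans ?_
  rw [totalDegree_C, zero_add]
  refine (totalDegree_sub _ _).trans (max_le ?_ (by simp))
  have h2 : (2 : MvPolynomial (Fin n) ℝ) = C 2 := (map_ofNat C 2).symm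
  rw [h2]
  exact (totalDegree_mul _ _).trans (by simp)

theorem totalDegree_aeval_le_of_totalDegree_le_one (u : Fin n → MvPolynomial (Fin n) ℝ)
    (hu : ∀ i, (u i).totalDegree ≤ 1) (f : MvPolynomial (Fin n) ℝ) :
    (aeval u f).totalDegree ≤ f.totalDegree := by
  rw [aeval_def, eval₂_eq']
  refine totalDegree_finsetSum_le fun s hs => ?_
  refine (totalDegree_mul _ _).trans ?_
  rw [algebraMap_eq, totalDegree_C, zero_add]
  refine (totalDegree_finsetProd _ _).trans ?_
  have := le_totalDegree hs
  rw [Finsupp.sum_fintype _ _ (fun _ => rfl)] at this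
  refine le_trans (Finset.sum_le_sum fun i _ => ?_) this
  exact (totalDegree_pow _ _).trans (by simpa using Nat.mul_le_mul_left (s i) (hu i))

theorem aeval_toUnitCube_aeval_ofUnitCube {R : ℝ} (hR : R ≠ 0) (f : MvPolynomial (Fin n) ℝ) :
    aeval (toUnitCube R) (aeval (ofUnitCube R) f) = f := by
  have : (aeval (toUnitCube R)).comp (aeval (ofUnitCube R)) =
      AlgHom.id ℝ (MvPolynomial (Fin n) ℝ) := by
    refine algHom_ext fun i => ?_
    have h2 : (2 : MvPolynomial (Fin n) ℝ) = C 2 := (map_ofNat C 2).symm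
    simp only [AlgHom.comp_apply, aeval_X, ofUnitCube, map_mul, map_sub, map_one, toUnitCube,
      algHom_C, algebraMap_eq, h2, AlgHom.id_apply]
    have h1 : (C 2 : MvPolynomial (Fin n) ℝ) * C (1 / 2) = 1 := by rw [← C_mul]; norm_num
    have h3 : (C R : MvPolynomial (Fin n) ℝ) * C (1 / R) = 1 := by
      rw [← C_mul, mul_one_div_cancel hR, C_1]
    linear_combination C R * (1 + C (1 / R) * X i) * h1 + X i * h3
  exact AlgHom.congr_fun this f

theorem eval_aeval (u : Fin n → MvPolynomial (Fin n) ℝ) (f : MvPolynomial (Fin n) ℝ)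
    (x : Fin n → ℝ) : eval x (aeval u f) = eval (fun i => eval x (u i)) f := by
  rw [aeval_def, eval₂_eq', map_sum, eval_eq']
  simp

/-- In an Archimedean quadratic module, polynomials with positive lower bound on the cube have
representations of explicitly bounded degree. -/
theorem exists_aeval_toUnitCube_mem {R : ℝ}
    {k₀ : ℕ} (hy : 1 - ∑ i, (C (1 / R) * X i) ^ 2 ∈ QMod g k₀) :
    ∃ k₁ : ℕ, ∀ (F : MvPolynomial (Fin n) ℝ) (μ : ℝ) (r : ℕ), 0 < r → F.totalDegree ≤ 2 * r →
      l1Norm F * (F.totalDegree : ℝ) ^ 2 ≤ μ * (2 * r) →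
      (∀ x : Fin n → ℝ, (∀ i, x i ∈ Set.Icc (0 : ℝ) 1) → μ ≤ eval x F) →
      aeval (toUnitCube R) F ∈ QMod g (k₁ + n * r) := by
  classical
  obtain ⟨k₁, hk₁⟩ := exists_prod_one_sub_sq_mem _ hy
  refine ⟨k₁, fun F μ r hr hdeg hlarge hF => ?_⟩
  obtain ⟨b, hb, hFb⟩ := exists_bernstein_coeff_nonneg F μ (k := 2 * r) (by omega) hdeg
    (by push_cast; exact hlarge) hF
  rw [hFb, map_sum]
  refine QMod.sum_mem _ _ fun ν hν => ?_
  rw [map_mul, algHom_C, algebraMap_eq]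
  refine QMod.C_mul_mem ?_ (hb ν hν)
  have hνk : ∀ i, ν i ≤ 2 * r := fun i => by
    have := Fintype.mem_piFinset.1 hν i
    simpa [Nat.lt_succ_iff] using this
  set u : Fin n → MvPolynomial (Fin n) ℝ := toUnitCube R with hu
  set S : Finset (Fin n) := Finset.univ.filter fun i => ν i % 2 = 1 with hS
  set s : MvPolynomial (Fin n) ℝ :=
    ∏ i, (u i ^ (ν i / 2) * (1 - u i) ^ ((2 * r - ν i) / 2)) with hs
  have hdu' : ∀ i, (1 - u i).totalDegree ≤ 1 := fun i =>
    (totalDegree_sub _ _).trans (max_le (by simp) (totalDegree_toUnitCube_le R i))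
  have hsdeg : s.totalDegree ≤ n * r := by
    refine (totalDegree_finsetProd _ _).trans ?_
    refine (Finset.sum_le_card_nsmul _ _ r fun i _ => ?_).trans (by simp)
    refine (totalDegree_mul _ _).trans ?_
    have h1 := (totalDegree_pow (u i) (ν i / 2)).trans
      (Nat.mul_le_mul_left _ (totalDegree_toUnitCube_le R i))
    have h2 := (totalDegree_pow (1 - u i) ((2 * r - ν i) / 2)).trans
      (Nat.mul_le_mul_left _ (hdu' i))
    have := hνk i
    omega
  have hfac : ∀ i, u i ^ ν i * (1 - u i) ^ (2 * r - ν i) =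
      (u i ^ (ν i / 2) * (1 - u i) ^ ((2 * r - ν i) / 2)) ^ 2 *
        (if ν i % 2 = 1 then u i * (1 - u i) else 1) := by
    intro i
    have := hνk i
    have hpow : ∀ (v : MvPolynomial (Fin n) ℝ) (a : ℕ), v ^ a = (v ^ (a / 2)) ^ 2 * v ^ (a % 2) :=
      fun v a => by rw [← pow_mul, ← pow_add, Nat.div_add_mod']
    rw [hpow (u i) (ν i), hpow (1 - u i) (2 * r - ν i)]
    split_ifs with h
    · rw [h, show (2 * r - ν i) % 2 = 1 by omega]
      ring
    · rw [show ν i % 2 = 0 by omega, show (2 * r - ν i) % 2 = 0 by omega]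
      ring
  have hfour : ∀ i, u i * (1 - u i) = C (1 / 4) * (1 - (C (1 / R) * X i) ^ 2) := by
    intro i
    rw [hu, toUnitCube]
    have h1 : (C (1 / 4) : MvPolynomial (Fin n) ℝ) = C (1 / 2) ^ 2 := by
      rw [← C_pow]; norm_num
    have h2 : (1 : MvPolynomial (Fin n) ℝ) = C (1 / 2) + C (1 / 2) := by
      rw [← C_add]; norm_num
    rw [h1]
    linear_combination (C (1 / 2) * (1 + C (1 / R) * X i)) * h2
  have hprod : aeval u (∏ i, ((X i : MvPolynomial (Fin n) ℝ) ^ ν i * (1 - X i) ^ (2 * r - ν i))) =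
      C ((1 / 4) ^ S.card) * (s ^ 2 * ∏ i ∈ S, (1 - (C (1 / R) * X i) ^ 2)) := by
    rw [map_prod]
    simp only [map_mul, map_pow, map_sub, map_one, aeval_X]
    rw [Finset.prod_congr rfl fun i _ => hfac i, Finset.prod_mul_distrib, Finset.prod_pow,
      ← Finset.prod_filter, ← hs, ← hS, Finset.prod_congr rfl fun i _ => hfour i,
      Finset.prod_mul_distrib (s := S), Finset.prod_const]
    ring
  rw [hprod]
  exact QMod.C_mul_mem (QMod.sq_mul_mem (hk₁ S) hsdeg) (by positivity)

end QuadraticModule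

theorem mul_one_sub_pow_le {t : ℝ} (ht : t ≤ 1) {l : ℕ} (hl : 0 < l) :
    t * (1 - t) ^ (2 * l) ≤ 1 / (2 * l) := by
  have hl' : (0 : ℝ) < l := by exact_mod_cast hl
  rcases le_total t 0 with h | h
  · exact (mul_nonpos_of_nonpos_of_nonneg h (pow_nonneg (by linarith) _)).trans (by positivity)
  · have h1 : (1 - t) ^ (2 * l) * (1 + t) ^ (2 * l) ≤ 1 := by
      rw [← mul_pow]
      exact pow_le_one₀ (mul_nonneg (by linarith) (by linarith)) (by nlinarith)
    have h2 : 1 + (2 * l : ℕ) * t ≤ (1 + t) ^ (2 * l) := one_add_mul_le_pow (by linarith) _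
    push_cast at h2
    have h3 : 0 ≤ (1 - t) ^ (2 * l) := pow_nonneg (by linarith) _
    rw [le_div_iff₀ (by positivity)]
    nlinarith [mul_le_mul_of_nonneg_left h2 h3]

theorem exists_one_sub_sum_sq_mem {n m : ℕ} {g : Fin m → MvPolynomial (Fin n) ℝ}
    (hArch : IsArchimedeanQM g) :
    ∃ R : ℝ, 0 < R ∧ ∃ k₀ : ℕ, 1 - ∑ i, (C (1 / R) * X i) ^ 2 ∈ QMod g k₀ := by
  obtain ⟨M, hM, k₀, hk⟩ := hArch
  refine ⟨M + 1, by linarith, k₀, ?_⟩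
  have h1 : (1 : MvPolynomial (Fin n) ℝ) - ∑ i, (C (1 / (M + 1)) * X i) ^ 2 =
      C ((1 / (M + 1)) ^ 2) * (C M - ∑ i, X i ^ 2) + C (1 - (1 / (M + 1)) ^ 2 * M) * 1 := by
    simp only [mul_pow, ← Finset.mul_sum, C_sub, C_mul, C_pow, C_1]
    ring
  rw [h1]
  refine QMod.add_mem (QMod.C_mul_mem hk (by positivity)) (QMod.C_mul_mem (QMod.one_mem _) ?_)
  rw [sub_nonneg, div_pow, one_pow, div_mul_eq_mul_div, one_mul, div_le_one (by positivity)]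
  nlinarith

/-- An effective Putinar representation: a polynomial bounded below by `1 / Z` on the part of the
unit cube where all constraints are at least `-1 / Z` lies in a truncation of order `2 ^ Z ^ c`. -/
theorem exists_aeval_toUnitCube_mem_of_near {n m : ℕ} {g : Fin m → MvPolynomial (Fin n) ℝ}
    {R : ℝ} (hR : 0 < R) {k₀ : ℕ} (hy : 1 - ∑ i, (C (1 / R) * X i) ^ 2 ∈ QMod g k₀) :
    ∃ c : ℕ, ∀ (Z : ℕ) (f : MvPolynomial (Fin n) ℝ), c ≤ Z → l1Norm f ≤ Z → f.totalDegree ≤ Z →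
      (∀ z : Fin n → ℝ, (∀ i, z i ∈ Set.Icc (0 : ℝ) 1) →
        (∀ j, -(1 / (Z : ℝ)) ≤ eval z (aeval (ofUnitCube R) (g j))) → 1 / (Z : ℝ) ≤ eval z f) →
      ∀ k : ℕ, 2 ^ Z ^ 10 ≤ k → aeval (toUnitCube R) f ∈ QMod g k := by
  classical
  obtain ⟨k₁, hk₁⟩ := exists_aeval_toUnitCube_mem hy
  set G : Fin m → MvPolynomial (Fin n) ℝ := fun j => aeval (ofUnitCube R) (g j) with hG
  obtain ⟨Γ, hΓ⟩ := exists_nat_ge (∑ j, l1Norm (G j))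
  refine ⟨2 + k₁ + n + m + Γ + ∑ j, (g j).totalDegree, fun Z f hZ hfn hfd hf k hk => ?_⟩
  have hZ2 : 2 ≤ Z := by omega
  have hZr : (2 : ℝ) ≤ Z := by exact_mod_cast hZ2
  have hZ0 : (0 : ℝ) < Z := by linarith
  have hmZ : (m : ℝ) ≤ Z := by exact_mod_cast (by omega : m ≤ Z)
  have hdg : ∀ j, (g j).totalDegree ≤ Z := fun j =>
    (Finset.single_le_sum (f := fun j => (g j).totalDegree) (fun _ _ => Nat.zero_le _)
      (Finset.mem_univ j)).trans (by omega)
  have hdG : ∀ j, (G j).totalDegree ≤ Z := fun j =>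
    (totalDegree_aeval_le_of_totalDegree_le_one _ (totalDegree_ofUnitCube_le R) _).trans (hdg j)
  have hlG : ∀ j, l1Norm (G j) ≤ Z := fun j =>
    ((Finset.single_le_sum (f := fun j => l1Norm (G j)) (fun _ _ => l1Norm_nonneg _)
      (Finset.mem_univ j)).trans hΓ).trans (by exact_mod_cast (by omega : Γ ≤ Z))
  set l : ℕ := 2 * Z ^ 5 with hl
  have hlpos : 0 < l := by positivity
  have hlr : (l : ℝ) = 2 * (Z : ℝ) ^ 5 := by rw [hl]; push_cast; ring
  set H : Fin m → MvPolynomial (Fin n) ℝ := fun j => C (1 / (Z : ℝ)) * G j with hH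
  have hlH : ∀ j, l1Norm (H j) ≤ 1 := fun j => by
    refine (l1Norm_mul_le _ _).trans ?_
    refine (mul_le_mul (l1Norm_C_le _) (hlG j) (l1Norm_nonneg _) (abs_nonneg _)).trans ?_
    rw [abs_of_pos (by positivity), one_div, inv_mul_cancel₀ hZ0.ne']
  have hdH : ∀ j, (H j).totalDegree ≤ Z := fun j => by
    refine (totalDegree_mul _ _).trans ?_
    rw [totalDegree_C, zero_add]
    exact hdG j
  set E : MvPolynomial (Fin n) ℝ := ∑ j, (1 - H j) ^ (2 * l) * H j with hE
  set F : MvPolynomial (Fin n) ℝ := f - C (2 * (Z : ℝ) ^ 3) * E with hF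
  have hd1H : ∀ j, (1 - H j).totalDegree ≤ Z := fun j =>
    (totalDegree_sub _ _).trans (max_le (by simp) (hdH j))
  have hdF : F.totalDegree ≤ 5 * Z ^ 6 := by
    refine (totalDegree_sub _ _).trans (max_le ?_ ?_)
    · exact hfd.trans (by nlinarith [Nat.pow_le_pow_right (by omega : 1 ≤ Z) (by omega : 1 ≤ 6)])
    · refine (totalDegree_mul _ _).trans ?_
      rw [totalDegree_C, zero_add]
      refine totalDegree_finsetSum_le fun j _ => (totalDegree_mul _ _).trans ?_
      have h1 := (totalDegree_pow (1 - H j) (2 * l)).trans (Nat.mul_le_mul_left _ (hd1H j))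
      have h2 : 2 * l * Z + Z ≤ 5 * Z ^ 6 := by
        have := Nat.pow_le_pow_right (by omega : 1 ≤ Z) (by omega : 1 ≤ 6)
        rw [hl]
        nlinarith
      exact (add_le_add h1 (hdH j)).trans h2
  have hlF : l1Norm F ≤ 3 * (Z : ℝ) ^ 4 * 2 ^ (4 * Z ^ 5) := by
    have h1 : ∀ j ∈ Finset.univ, l1Norm ((1 - H j) ^ (2 * l) * H j) ≤ 2 ^ (4 * Z ^ 5) := by
      intro j _
      refine (l1Norm_mul_le _ _).trans ?_
      have h2 : l1Norm (1 - H j) ≤ 2 := by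
        refine (l1Norm_sub_le _ _).trans ?_
        have := l1Norm_C_le (n := n) 1
        rw [C_1, abs_one] at this
        linarith [hlH j]
      have h3 : l1Norm ((1 - H j) ^ (2 * l)) ≤ 2 ^ (4 * Z ^ 5) := by
        refine (l1Norm_pow_le _ _).trans ((pow_le_pow_left₀ (l1Norm_nonneg _) h2 _).trans_eq ?_)
        congr 1
        rw [hl]
        ring
      exact (mul_le_mul h3 (hlH j) (l1Norm_nonneg _) (by positivity)).trans_eq (mul_one _)
    have h2 : l1Norm E ≤ Z * 2 ^ (4 * Z ^ 5) := by
      refine (l1Norm_sum_le _ _).trans ((Finset.sum_le_card_nsmul _ _ _ h1).trans ?_)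
      rw [nsmul_eq_mul, Finset.card_univ, Fintype.card_fin]
      gcongr
    have h3 : l1Norm (C (2 * (Z : ℝ) ^ 3) * E) ≤ 2 * (Z : ℝ) ^ 3 * (Z * 2 ^ (4 * Z ^ 5)) := by
      refine (l1Norm_mul_le _ _).trans (mul_le_mul ?_ h2 (l1Norm_nonneg _) (by positivity))
      exact (l1Norm_C_le _).trans_eq (abs_of_pos (by positivity))
    have h4 : (Z : ℝ) ≤ (Z : ℝ) ^ 4 * 2 ^ (4 * Z ^ 5) := by
      have h5 : (Z : ℝ) ^ 1 ≤ (Z : ℝ) ^ 4 := pow_le_pow_right₀ (by linarith) (by norm_num)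
      have h6 : (1 : ℝ) ≤ 2 ^ (4 * Z ^ 5) := one_le_pow₀ (by norm_num)
      rw [pow_one] at h5
      exact h5.trans (le_mul_of_one_le_right (by positivity) h6)
    refine (l1Norm_sub_le _ _).trans ((add_le_add (hfn.trans h4) h3).trans_eq (by ring))
  set r : ℕ := 75 * Z ^ 17 * 2 ^ (4 * Z ^ 5) with hr
  have hrE : 5 * Z ^ 6 ≤ r := by
    have h1 : Z ^ 6 ≤ Z ^ 17 := Nat.pow_le_pow_right (by omega) (by norm_num)
    have h2 : 1 ≤ 2 ^ (4 * Z ^ 5) := Nat.one_le_two_pow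
    calc 5 * Z ^ 6 ≤ 75 * Z ^ 17 * 1 := by omega
      _ ≤ r := Nat.mul_le_mul_left _ h2
  have hZ6 : Z ≤ Z ^ 6 := by
    simpa using Nat.pow_le_pow_right (by omega : 1 ≤ Z) (by omega : 1 ≤ 6)
  have hkr : Z + Z * r ≤ k := by
    refine le_trans ?_ hk
    have h1 : 1 ≤ r := by omega
    have hZp : Z ≤ 2 ^ Z := Nat.lt_two_pow_self.le
    have hZ5 : Z ≤ Z ^ 5 := by
      simpa using Nat.pow_le_pow_right (by omega : 1 ≤ Z) (by omega : 1 ≤ 5)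
    have h32 : 32 ≤ Z ^ 5 := by
      simpa using Nat.pow_le_pow_left hZ2 5
    calc Z + Z * r ≤ 2 * (Z * r) := by nlinarith
      _ = 150 * Z ^ 18 * 2 ^ (4 * Z ^ 5) := by rw [hr]; ring
      _ ≤ 2 ^ 8 * (2 ^ Z) ^ 18 * 2 ^ (4 * Z ^ 5) := by gcongr; norm_num
      _ = 2 ^ (8 + Z * 18 + 4 * Z ^ 5) := by rw [← pow_mul, ← pow_add, ← pow_add]
      _ ≤ 2 ^ Z ^ 10 := by
        refine Nat.pow_le_pow_right (by norm_num) ?_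
        have : Z ^ 10 = Z ^ 5 * Z ^ 5 := by ring
        nlinarith
  have hFmem : aeval (toUnitCube R) F ∈ QMod g (k₁ + n * r) := by
    refine hk₁ F (1 / (2 * Z)) r (by omega) (by omega) ?_ ?_
    · have h1 : l1Norm F * (F.totalDegree : ℝ) ^ 2 ≤
          (3 * (Z : ℝ) ^ 4 * 2 ^ (4 * Z ^ 5)) * (5 * (Z : ℝ) ^ 6) ^ 2 := by
        refine mul_le_mul hlF ?_ (by positivity) (by positivity)
        refine pow_le_pow_left₀ (by positivity) ?_ 2
        exact_mod_cast hdF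
      refine h1.trans_eq ?_
      rw [hr]
      push_cast
      field_simp
      ring
    · intro z hz
      have hHz : ∀ j, |eval z (H j)| ≤ 1 := fun j => (abs_eval_le_l1Norm _ hz).trans (hlH j)
      have hfz := (abs_le.1 ((abs_eval_le_l1Norm f hz).trans hfn)).1
      have hEterm : ∀ j, (1 - eval z (H j)) ^ (2 * l) * eval z (H j) ≤ 1 / (2 * l) := fun j => by
        rw [mul_comm]
        exact mul_one_sub_pow_le (abs_le.1 (hHz j)).2 hlpos
      have hsmall : 2 * (Z : ℝ) ^ 3 * (Z * (1 / (2 * l))) ≤ 1 / (2 * Z) := by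
        rw [hlr]
        refine le_of_eq ?_
        field_simp
      have hFz : eval z F = eval z f -
          2 * (Z : ℝ) ^ 3 * ∑ j, (1 - eval z (H j)) ^ (2 * l) * eval z (H j) := by
        simp [hF, hE]
      rw [hFz]
      have hl0 : (0 : ℝ) ≤ 1 / (2 * l) := by positivity
      have hhalf : 1 / (2 * (Z : ℝ)) + 1 / (2 * Z) = 1 / Z := by field_simp; norm_num
      have hinv : 1 / (Z : ℝ) ≤ 1 := by rw [div_le_one hZ0]; linarith
      by_cases hall : ∀ j, -(1 / (Z : ℝ)) ≤ eval z (G j)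
      · have h1 := hf z hz hall
        have h2 : ∑ j, (1 - eval z (H j)) ^ (2 * l) * eval z (H j) ≤ Z * (1 / (2 * l)) := by
          refine (Finset.sum_le_card_nsmul _ _ _ fun j _ => hEterm j).trans ?_
          rw [nsmul_eq_mul, Finset.card_univ, Fintype.card_fin]
          gcongr
        have h3 := mul_le_mul_of_nonneg_left h2 (by positivity : (0 : ℝ) ≤ 2 * (Z : ℝ) ^ 3)
        linarith
      · push Not at hall
        obtain ⟨j₀, hj₀⟩ := hall
        have hHj : eval z (H j₀) ≤ -(1 / (Z : ℝ) ^ 2) := by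
          have : eval z (H j₀) = 1 / (Z : ℝ) * eval z (G j₀) := by simp [hH]
          rw [this]
          have := mul_le_mul_of_nonneg_left hj₀.le (by positivity : 0 ≤ 1 / (Z : ℝ))
          refine this.trans_eq ?_
          field_simp
        have hterm : (1 - eval z (H j₀)) ^ (2 * l) * eval z (H j₀) ≤ -(1 / (Z : ℝ) ^ 2) := by
          have hneg : eval z (H j₀) ≤ 0 := hHj.trans (neg_nonpos.2 (by positivity))
          have h1 : 1 ≤ (1 - eval z (H j₀)) ^ (2 * l) := one_le_pow₀ (by linarith)
          nlinarith
        have h2 : ∑ j, (1 - eval z (H j)) ^ (2 * l) * eval z (H j) ≤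
            -(1 / (Z : ℝ) ^ 2) + Z * (1 / (2 * l)) := by
          rw [← Finset.add_sum_erase _ _ (Finset.mem_univ j₀)]
          refine add_le_add hterm ((Finset.sum_le_card_nsmul _ _ _ fun j _ => hEterm j).trans ?_)
          rw [nsmul_eq_mul]
          refine mul_le_mul_of_nonneg_right (le_trans ?_ hmZ) hl0
          have := Finset.card_erase_le (s := (Finset.univ : Finset (Fin m))) (a := j₀)
          rw [Finset.card_univ, Fintype.card_fin] at this
          exact_mod_cast this
        have h3 := mul_le_mul_of_nonneg_left h2 (by positivity : (0 : ℝ) ≤ 2 * (Z : ℝ) ^ 3)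
        have h4 : 2 * (Z : ℝ) ^ 3 * (-(1 / (Z : ℝ) ^ 2) + Z * (1 / (2 * l))) =
            -(2 * Z) + 2 * (Z : ℝ) ^ 3 * (Z * (1 / (2 * l))) := by
          field_simp
        rw [h4] at h3
        linarith
  have hdecomp : aeval (toUnitCube R) f = aeval (toUnitCube R) F + C (2 * (Z : ℝ) ^ 3) *
      ∑ j, ((1 - C (1 / (Z : ℝ)) * g j) ^ l) ^ 2 * (C (1 / (Z : ℝ)) * g j) := by
    have h1 : f = F + C (2 * (Z : ℝ) ^ 3) * E := by rw [hF]; ring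
    have h2 : ∀ j, aeval (toUnitCube R) (H j) = C (1 / (Z : ℝ)) * g j := fun j => by
      rw [hH, map_mul, algHom_C, algebraMap_eq, hG, aeval_toUnitCube_aeval_ofUnitCube hR.ne']
    conv_lhs => rw [h1]
    rw [map_add, map_mul, algHom_C, algebraMap_eq, hE, map_sum]
    simp only [map_mul, map_pow, map_sub, map_one, h2]
    congr 2
    refine Finset.sum_congr rfl fun j _ => ?_
    rw [← pow_mul, mul_comm l 2]
  rw [hdecomp]
  refine QMod.add_mem (QMod.mono (le_trans ?_ hkr) hFmem)
    (QMod.C_mul_mem (QMod.sum_mem _ _ fun j _ => ?_) (by positivity))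
  · exact add_le_add (by omega) (Nat.mul_le_mul_right _ (by omega))
  · have hs : ((1 - C (1 / (Z : ℝ)) * g j) ^ l).totalDegree ≤ l * Z := by
      refine (totalDegree_pow _ _).trans (Nat.mul_le_mul_left _ ?_)
      refine (totalDegree_sub _ _).trans (max_le (by simp) ?_)
      refine (totalDegree_mul _ _).trans ?_
      rw [totalDegree_C, zero_add]
      exact hdg j
    have hgm : C (1 / (Z : ℝ)) * g j ∈ QMod g Z :=
      QMod.C_mul_mem (QMod.generator_mem j ((hdg j).trans (by omega))) (by positivity)
    refine QMod.mono (le_trans ?_ hkr) (QMod.sq_mul_mem hgm hs)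
    have : l ≤ r := by
      refine le_trans ?_ hrE
      have : Z ^ 5 ≤ Z ^ 6 := Nat.pow_le_pow_right (by omega) (by norm_num)
      omega
    rw [mul_comm Z r]
    exact Nat.add_le_add_left (Nat.mul_le_mul_right _ this) _

section GeomInv

variable {n : ℕ}

/-- The truncated Neumann series of `1 / f`, scaled by `b`. -/
def geomInv (f : MvPolynomial (Fin n) ℝ) (b : ℝ) (L : ℕ) : MvPolynomial (Fin n) ℝ :=
  C (1 / b) * ∑ j ∈ Finset.range L, (1 - C (1 / b) * f) ^ j

theorem geomInv_mul (f : MvPolynomial (Fin n) ℝ) (b : ℝ) (L : ℕ) :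
    geomInv f b L * f = 1 - (1 - C (1 / b) * f) ^ L := by
  rw [← geom_sum_mul_neg (1 - C (1 / b) * f) L, geomInv]
  ring

theorem l1Norm_geomInv_le {f : MvPolynomial (Fin n) ℝ} {b : ℝ} (hb : 1 ≤ b) (hf : l1Norm f ≤ b)
    (L : ℕ) : l1Norm (geomInv f b L) ≤ L * 2 ^ L := by
  have hb1 : |1 / b| ≤ 1 := by
    rw [abs_of_pos (by positivity), div_le_one (by linarith)]
    exact hb
  have h1 : l1Norm (1 - C (1 / b) * f) ≤ 2 := by
    refine (l1Norm_sub_le _ _).trans ?_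
    have h2 := l1Norm_C_le (n := n) 1
    rw [C_1, abs_one] at h2
    have h3 : l1Norm (C (1 / b) * f) ≤ 1 := by
      refine (l1Norm_mul_le _ _).trans ((mul_le_mul (l1Norm_C_le _) hf (l1Norm_nonneg _)
        (abs_nonneg _)).trans_eq ?_)
      rw [abs_of_pos (by positivity), one_div, inv_mul_cancel₀ (by linarith)]
    linarith
  refine (l1Norm_mul_le _ _).trans ?_
  refine (mul_le_of_le_one_left (l1Norm_nonneg _) ((l1Norm_C_le _).trans hb1)).trans ?_
  refine (l1Norm_sum_le _ _).trans ?_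
  refine (Finset.sum_le_card_nsmul _ _ (2 ^ L) fun j hj => ?_).trans (by simp)
  refine (l1Norm_pow_le _ _).trans ((pow_le_pow_left₀ (l1Norm_nonneg _) h1 j).trans ?_)
  exact pow_le_pow_right₀ (by norm_num) (Finset.mem_range.1 hj).le

theorem totalDegree_geomInv_le (f : MvPolynomial (Fin n) ℝ) (b : ℝ) (L : ℕ) :
    (geomInv f b L).totalDegree ≤ L * f.totalDegree := by
  refine (totalDegree_mul _ _).trans ?_
  rw [totalDegree_C, zero_add]
  refine totalDegree_finsetSum_le fun j hj => (totalDegree_pow _ _).trans ?_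
  refine Nat.mul_le_mul (Finset.mem_range.1 hj).le ?_
  refine (totalDegree_sub _ _).trans (max_le (by simp) ?_)
  refine (totalDegree_mul _ _).trans ?_
  rw [totalDegree_C, zero_add]

/-- At points where `a ≤ f ≤ b` the truncated Neumann series inverts `f` up to a geometric error. -/
theorem exists_eval_geomInv_mul {f : MvPolynomial (Fin n) ℝ} {a b : ℝ} (ha : 0 < a)
    (L : ℕ) {z : Fin n → ℝ} (hz : a ≤ eval z f) (hzb : eval z f ≤ b) :
    ∃ e : ℝ, 0 ≤ e ∧ e ≤ (1 - a / b) ^ L ∧ eval z (geomInv f b L) * eval z f = 1 - e := by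
  have hb : 0 < b := ha.trans_le (hz.trans hzb)
  have h1 : eval z (1 - C (1 / b) * f) = 1 - eval z f / b := by
    simp only [map_sub, map_one, map_mul, eval_C]
    ring
  have h0 : 0 ≤ 1 - eval z f / b := by
    rw [sub_nonneg, div_le_one hb]
    exact hzb
  refine ⟨(1 - eval z f / b) ^ L, pow_nonneg h0 _, pow_le_pow_left₀ h0 ?_ _, ?_⟩
  · gcongr
  · rw [← map_mul, geomInv_mul, map_sub, map_pow, h1, map_one]

end GeomInv

theorem div_two_le_sub_mul {P Q S e a B δ E : ℝ} (ha : 0 < a) (hB : 0 ≤ B) (hP : |P| ≤ B)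
    (hQ : a ≤ Q) (he : 0 ≤ e) (heE : e ≤ E) (hδ : 0 ≤ δ) (hE : B * E ≤ δ * a / 2)
    (hS : S * Q = 1 - e) :
    δ * a / 2 ≤ P - (P * S - δ) * Q ∧ P / Q - 2 * δ ≤ P * S - δ := by
  have hPe : |P * e| ≤ δ * a / 2 := by
    rw [abs_mul, abs_of_nonneg he]
    exact (mul_le_mul hP heE he hB).trans hE
  have hPe' := abs_le.1 hPe
  have hQ0 : 0 < Q := by linarith
  have hδQ : δ * a ≤ δ * Q := mul_le_mul_of_nonneg_left hQ hδ
  have h1 : P - (P * S - δ) * Q = P * e + δ * Q := by linear_combination (-P) * hS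
  refine ⟨by rw [h1]; linarith, ?_⟩
  have h2 : P * S = (P - P * e) / Q := by
    rw [eq_div_iff hQ0.ne']
    linear_combination P * hS
  rw [h2, sub_div]
  have h3 : P * e / Q ≤ δ := by
    rw [div_le_iff₀ hQ0]
    linarith [mul_nonneg hδ ha.le]
  linarith

/-- A sum of fractions is bounded below wherever the numerator of the cleared difference is. -/
theorem neg_le_sum_div_sub {N : ℕ} {P Q : Fin N → ℝ} {a s t ρ : ℝ} (ha : 0 < a)
    (hQ : ∀ i, a ≤ Q i) (hs : s ≤ a ^ N * t) (ht : 0 ≤ t)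
    (h : -s ≤ ∑ i, P i * ∏ j ∈ Finset.univ.erase i, Q j - ρ * ∏ j, Q j) :
    -t ≤ ∑ i, P i / Q i - ρ := by
  have hQ0 : ∀ i, 0 < Q i := fun i => ha.trans_le (hQ i)
  have hprod : a ^ N ≤ ∏ j, Q j := by
    have := Finset.prod_le_prod (s := Finset.univ) (f := fun _ : Fin N => a) (g := Q)
      (fun _ _ => ha.le) fun i _ => hQ i
    simpa using this
  have hpos : 0 < ∏ j, Q j := Finset.prod_pos fun i _ => hQ0 i
  have h1 : ∑ i, P i * ∏ j ∈ Finset.univ.erase i, Q j - ρ * ∏ j, Q j =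
      (∑ i, P i / Q i - ρ) * ∏ j, Q j := by
    rw [sub_mul, Finset.sum_mul]
    congr 1
    refine Finset.sum_congr rfl fun i _ => ?_
    rw [← Finset.mul_prod_erase _ _ (Finset.mem_univ i), div_mul_eq_mul_div, mul_left_comm,
      mul_div_cancel_left₀ _ (hQ0 i).ne']
  rw [h1] at h
  by_contra hcon
  push Not at hcon
  have h2 : (∑ i, P i / Q i - ρ) * ∏ j, Q j < -t * ∏ j, Q j := mul_lt_mul_of_pos_right hcon hpos
  have h3 : a ^ N * t ≤ t * ∏ j, Q j := by
    rw [mul_comm]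
    exact mul_le_mul_of_nonneg_left hprod ht
  linarith

/-- Points of the unit cube that almost satisfy the constraints almost satisfy every polynomial
inequality implied by them. -/
theorem exists_neg_le_eval_aeval_ofUnitCube {n m : ℕ} (g : Fin m → MvPolynomial (Fin n) ℝ)
    (f : MvPolynomial (Fin n) ℝ) (R : ℝ)
    (hf : ∀ x, (∀ j, 0 ≤ eval x (g j)) → 0 ≤ eval x f) :
    ∃ c > 0, ∃ k : ℕ, ∀ s, 0 < s → s ≤ 1 → ∀ η < c * s ^ k, ∀ z : Fin n → ℝ,
      (∀ i, z i ∈ Set.Icc (0 : ℝ) 1) → (∀ j, -η ≤ eval z (aeval (ofUnitCube R) (g j))) →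
      -s ≤ eval z (aeval (ofUnitCube R) f) := by
  obtain ⟨c, hc, k, h⟩ := exists_eval_le_neg_of_sum_sq_le
    (fun j => aeval (ofUnitCube R) (g j)) (aeval (ofUnitCube R) f) n
    (fun x hx => by
      rw [eval_aeval]
      exact hf _ fun j => by simpa only [eval_aeval] using hx j)
  refine ⟨c, hc, k, fun s hs hs1 η hη z hz hzη => ?_⟩
  by_contra hcon
  push Not at hcon
  have hzn : ∑ i, z i ^ 2 ≤ n := by
    refine (Finset.sum_le_card_nsmul _ _ 1 fun i _ => pow_le_one₀ (hz i).1 (hz i).2).trans ?_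
    simp
  obtain ⟨j, hj⟩ := h s hs hs1 z hzn hcon.le
  linarith [hzη j]

theorem exists_le_eval_aeval_ofUnitCube {n m N : ℕ} (g : Fin m → MvPolynomial (Fin n) ℝ)
    (q : Fin N → MvPolynomial (Fin n) ℝ) (R : ℝ) {a : ℝ} (ha : 0 < a) (ha1 : a ≤ 1)
    (hq : ∀ x, (∀ j, 0 ≤ eval x (g j)) → ∀ i, 2 * a ≤ eval x (q i)) :
    ∃ η₀ > 0, ∀ z : Fin n → ℝ, (∀ i, z i ∈ Set.Icc (0 : ℝ) 1) →
      (∀ j, -η₀ ≤ eval z (aeval (ofUnitCube R) (g j))) →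
      ∀ i, a ≤ eval z (aeval (ofUnitCube R) (q i)) := by
  have h : ∀ i, ∃ η > 0, ∀ z : Fin n → ℝ, (∀ i, z i ∈ Set.Icc (0 : ℝ) 1) →
      (∀ j, -η ≤ eval z (aeval (ofUnitCube R) (g j))) →
      a ≤ eval z (aeval (ofUnitCube R) (q i)) := by
    intro i
    obtain ⟨c, hc, k, h⟩ := exists_neg_le_eval_aeval_ofUnitCube g (q i - C (2 * a)) R
      (fun x hx => by simpa using hq x hx i)
    have hpos : 0 < c * a ^ k := by positivity
    refine ⟨c * a ^ k / 2, by positivity, fun z hz hzη => ?_⟩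
    have := h a ha ha1 _ (half_lt_self hpos) z hz hzη
    rw [map_sub, algHom_C, algebraMap_eq, map_sub, eval_C] at this
    linarith
  choose η hη h using h
  rcases Nat.eq_zero_or_pos N with rfl | hN
  · exact ⟨1, one_pos, fun _ _ _ i => i.elim0⟩
  have : Nonempty (Fin N) := ⟨⟨0, hN⟩⟩
  refine ⟨Finset.univ.inf' Finset.univ_nonempty η, ?_, fun z hz hzη i => h i z hz fun j => ?_⟩
  · exact (Finset.lt_inf'_iff _).2 fun i _ => hη i
  · exact (neg_le_neg (Finset.inf'_le η (Finset.mem_univ i))).trans (hzη j)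

theorem le_pow_of_le_mul_pow {x : ℝ} {A B T W : ℕ} (hT : 1 ≤ T) (hW : A * B ≤ W)
    (hx : x ≤ (A : ℝ) * (B : ℝ) ^ T) : x ≤ ((W ^ T : ℕ) : ℝ) := by
  refine hx.trans ?_
  have h1 : A * B ^ T ≤ W ^ T := by
    calc A * B ^ T ≤ A ^ T * B ^ T := Nat.mul_le_mul_right _ (Nat.le_self_pow (by omega) A)
      _ = (A * B) ^ T := (mul_pow _ _ _).symm
      _ ≤ W ^ T := Nat.pow_le_pow_left hW T
  exact_mod_cast h1

set_option maxHeartbeats 1600000 in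
/-- Feasible points of the relaxation of value `ρ - 1 / T` exist in order `2 ^ W ^ T`. -/
theorem exists_feasible {n m N : ℕ} [NeZero N] (g : Fin m → MvPolynomial (Fin n) ℝ)
    (p q : Fin N → MvPolynomial (Fin n) ℝ) (hArch : IsArchimedeanQM g) {a ρ : ℝ} (ha : 0 < a)
    (ha1 : a ≤ 1) (hq : ∀ x, (∀ j, 0 ≤ eval x (g j)) → ∀ i, 2 * a ≤ eval x (q i))
    (hρ : ∀ x, (∀ j, 0 ≤ eval x (g j)) → ρ ≤ ∑ i, eval x (p i) / eval x (q i)) :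
    ∃ W : ℕ, ∀ T : ℕ, 1 ≤ T → ∀ k : ℕ, 2 ^ W ^ T ≤ k →
      ∃ h : Fin N → MvPolynomial (Fin n) ℝ,
        (∀ i : Fin N, i ≠ 0 →
          (h i).totalDegree ≤ 2 * k - max (q 0).totalDegree (q i).totalDegree) ∧
        (p 0 + ((∑ i ∈ Finset.univ.erase (0 : Fin N), h i) - C (ρ - 1 / T)) * q 0) ∈ QMod g k ∧
        (∀ i : Fin N, i ≠ 0 → (p i - h i * q i) ∈ QMod g k) := by
  classical
  have hN0 : 0 < N := Nat.pos_of_ne_zero (NeZero.ne N)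
  have hN1 : (1 : ℝ) ≤ N := by exact_mod_cast hN0
  obtain ⟨R, hR, k₀, hy⟩ := exists_one_sub_sum_sq_mem hArch
  obtain ⟨c₀, hmem⟩ := exists_aeval_toUnitCube_mem_of_near hR hy
  set ψ : MvPolynomial (Fin n) ℝ →ₐ[ℝ] MvPolynomial (Fin n) ℝ := aeval (ofUnitCube R) with hψ
  set φ : MvPolynomial (Fin n) ℝ →ₐ[ℝ] MvPolynomial (Fin n) ℝ := aeval (toUnitCube R) with hφ
  have hφψ : ∀ f, φ (ψ f) = f := aeval_toUnitCube_aeval_ofUnitCube hR.ne'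
  have hψC : ∀ c, ψ (C c) = C c := fun c => by rw [algHom_C, algebraMap_eq]
  have hφC : ∀ c, φ (C c) = C c := fun c => by rw [algHom_C, algebraMap_eq]
  have hψdeg : ∀ f, (ψ f).totalDegree ≤ f.totalDegree :=
    totalDegree_aeval_le_of_totalDegree_le_one _ (totalDegree_ofUnitCube_le R)
  have hφdeg : ∀ f, (φ f).totalDegree ≤ f.totalDegree :=
    totalDegree_aeval_le_of_totalDegree_le_one _ (totalDegree_toUnitCube_le R)
  obtain ⟨η₀, hη₀, hqnear⟩ := exists_le_eval_aeval_ofUnitCube g q R ha ha1 hq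
  obtain ⟨c, hc, e, hGnear⟩ := exists_neg_le_eval_aeval_ofUnitCube g
    (∑ i, p i * ∏ j ∈ Finset.univ.erase i, q j - C ρ * ∏ j, q j) R (by
      intro x hx
      have h0 : (0 : ℝ) ≤ ∑ i, eval x (p i) / eval x (q i) - ρ := sub_nonneg.2 (hρ x hx)
      have hpos : ∀ i, 0 < eval x (q i) := fun i => by linarith [hq x hx i]
      have h1 : eval x (∑ i, p i * ∏ j ∈ Finset.univ.erase i, q j - C ρ * ∏ j, q j) =
          (∑ i, eval x (p i) / eval x (q i) - ρ) * ∏ j, eval x (q j) := by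
        simp only [map_sub, map_sum, map_mul, map_prod, eval_C]
        rw [sub_mul, Finset.sum_mul]
        congr 1
        refine Finset.sum_congr rfl fun i _ => ?_
        rw [← Finset.mul_prod_erase _ _ (Finset.mem_univ i), div_mul_eq_mul_div, mul_left_comm,
          mul_div_cancel_left₀ _ (hpos i).ne']
      rw [h1]
      exact mul_nonneg h0 (Finset.prod_nonneg fun i _ => (hpos i).le))
  obtain ⟨β, hβ⟩ := exists_nat_ge (2 + ∑ i, l1Norm (ψ (p i)) + ∑ i, l1Norm (ψ (q i)) +
    ((∑ i, (p i).totalDegree : ℕ) : ℝ) + ((∑ i, (q i).totalDegree : ℕ) : ℝ) + N + |ρ| + 1 / a)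
  have hsp : 0 ≤ ∑ i, l1Norm (ψ (p i)) := Finset.sum_nonneg fun _ _ => l1Norm_nonneg _
  have hsq : 0 ≤ ∑ i, l1Norm (ψ (q i)) := Finset.sum_nonneg fun _ _ => l1Norm_nonneg _
  have hsdp : (0 : ℝ) ≤ ((∑ i, (p i).totalDegree : ℕ) : ℝ) := Nat.cast_nonneg _
  have hsdq : (0 : ℝ) ≤ ((∑ i, (q i).totalDegree : ℕ) : ℝ) := Nat.cast_nonneg _
  have hρ0 := abs_nonneg ρ
  have ha' : 0 < 1 / a := by positivity
  have hβ2 : (2 : ℝ) ≤ β := by linarith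
  have hβ1 : (1 : ℝ) ≤ β := by linarith
  have hβN : (N : ℝ) ≤ β := by linarith
  have hβρ : |ρ| + 1 ≤ β := by linarith
  have hβa : 1 / a ≤ β := by linarith
  have hβp : ∀ i, l1Norm (ψ (p i)) ≤ β := fun i => by
    have := Finset.single_le_sum (f := fun i => l1Norm (ψ (p i))) (fun _ _ => l1Norm_nonneg _)
      (Finset.mem_univ i)
    linarith
  have hβq : ∀ i, l1Norm (ψ (q i)) ≤ β := fun i => by
    have := Finset.single_le_sum (f := fun i => l1Norm (ψ (q i))) (fun _ _ => l1Norm_nonneg _)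
      (Finset.mem_univ i)
    linarith
  have hdp : ∀ i, (p i).totalDegree ≤ β := fun i => by
    have h1 := Finset.single_le_sum (f := fun i => (p i).totalDegree) (fun _ _ => Nat.zero_le _)
      (Finset.mem_univ i)
    have h2 : ((∑ i, (p i).totalDegree : ℕ) : ℝ) ≤ β := by linarith
    exact h1.trans (by exact_mod_cast h2)
  have hdq : ∀ i, (q i).totalDegree ≤ β := fun i => by
    have h1 := Finset.single_le_sum (f := fun i => (q i).totalDegree) (fun _ _ => Nat.zero_le _)
      (Finset.mem_univ i)
    have h2 : ((∑ i, (q i).totalDegree : ℕ) : ℝ) ≤ β := by linarith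
    exact h1.trans (by exact_mod_cast h2)
  have hβ0 : (0 : ℝ) < β := by linarith
  have hβnat : 2 ≤ β := by exact_mod_cast hβ2
  -- the exponent rate of the Neumann series
  set θ : ℝ := 1 - a / β with hθ
  have hθ0 : 0 ≤ θ := by
    rw [hθ, sub_nonneg, div_le_one hβ0]
    linarith
  have hθ1 : θ < 1 := by
    have : 0 < a / β := by positivity
    rw [hθ]
    linarith
  set τ : ℝ := a / (16 * N * β) with hτ
  have hτ0 : 0 < τ := by positivity
  have hτ1 : τ ≤ 1 / 2 := by
    have : 1 ≤ (N : ℝ) * β := one_le_mul_of_one_le_of_one_le hN1 hβ1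
    rw [hτ, div_le_iff₀ (by positivity)]
    linarith
  obtain ⟨l₀, hl₀⟩ := exists_pow_lt_of_lt_one hτ0 hθ1
  set l : ℕ := l₀ + 1 with hl
  have hθl : θ ^ l ≤ τ := by
    rw [hl, pow_succ]
    exact (mul_le_of_le_one_right (pow_nonneg hθ0 _) hθ1.le).trans hl₀.le
  obtain ⟨γ, hγ⟩ := exists_nat_ge (2 + 1 / η₀ + 2 / c * (4 / a ^ N) ^ e)
  have hγ1 : 0 < 1 / η₀ := by positivity
  have hγ2 : 0 < 2 / c * (4 / a ^ N) ^ e := by positivity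
  set W₀ : ℕ := c₀ + 6 * β ^ 3 * l * (2 * 2 ^ l) + 16 * β ^ 2 * 2 + γ * 2 ^ e + γ with hW₀
  refine ⟨W₀ ^ 10, fun T hT k hk => ?_⟩
  set Z : ℕ := W₀ ^ T with hZ
  have hk' : 2 ^ Z ^ 10 ≤ k := by
    rw [hZ, ← pow_mul, mul_comm T 10, pow_mul]
    exact hk
  have hT0 : (0 : ℝ) < T := by exact_mod_cast hT
  have hT1 : (1 : ℝ) ≤ T := by exact_mod_cast hT
  have hT2 : (T : ℝ) ≤ 2 ^ T := by exact_mod_cast Nat.lt_two_pow_self.le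
  have hγnat : 2 ≤ γ := by
    have : (2 : ℝ) ≤ γ := by linarith
    exact_mod_cast this
  have hc₀Z : c₀ ≤ Z := le_trans (by omega) (Nat.le_self_pow (by omega) W₀)
  set L : ℕ := l * T with hL
  set Y : ℝ := L * 2 ^ L with hY
  have hL1 : 1 ≤ L := Nat.mul_pos (by omega) hT
  have hLr : (1 : ℝ) ≤ L := by exact_mod_cast hL1
  have hYL : (L : ℝ) ≤ Y := le_mul_of_one_le_right (by linarith) (one_le_pow₀ (by norm_num))
  have hY1 : 1 ≤ Y := hLr.trans hYL
  have hYZ : 6 * (β : ℝ) ^ 3 * Y ≤ Z := by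
    refine le_pow_of_le_mul_pow (A := 6 * β ^ 3 * l) (B := 2 * 2 ^ l) (W := W₀) hT (by omega) ?_
    · push_cast
      rw [hY, hL, mul_pow, ← pow_mul]
      push_cast
      have : (0 : ℝ) ≤ 6 * (β : ℝ) ^ 3 * l * 2 ^ (l * T) := by positivity
      linarith [mul_le_mul_of_nonneg_left hT2 this]
  have hTZ : 16 * (β : ℝ) ^ 2 * T ≤ Z := by
    refine le_pow_of_le_mul_pow (A := 16 * β ^ 2) (B := 2) (W := W₀) hT (by omega) ?_
    · push_cast
      gcongr
  have hηZ : 1 / η₀ ≤ Z := by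
    have h1 : (γ : ℝ) ≤ Z := by
      exact_mod_cast le_trans (by omega) (Nat.le_self_pow (by omega) W₀)
    linarith
  set s : ℝ := a ^ N * (1 / (4 * T)) with hs
  have hs0 : 0 < s := by positivity
  have hs1 : s ≤ 1 := by
    refine mul_le_one₀ (pow_le_one₀ ha.le ha1) (by positivity) ?_
    rw [div_le_one (by positivity)]
    linarith
  have hZ0 : (0 : ℝ) < Z := hγ1.trans_le hηZ
  have hZη₀ : 1 / (Z : ℝ) ≤ η₀ := by
    rw [div_le_iff₀ hZ0]
    rwa [div_le_iff₀ hη₀, mul_comm] at hηZ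
  have hZs : 1 / (Z : ℝ) < c * s ^ e := by
    have h1 : 2 / c * (4 / a ^ N) ^ e * (T : ℝ) ^ e ≤ Z := by
      refine le_pow_of_le_mul_pow (A := γ) (B := 2 ^ e) (W := W₀) hT (by omega) ?_
      push_cast
      have h2 : (T : ℝ) ^ e ≤ (2 ^ e) ^ T := by
        rw [← pow_mul, mul_comm, pow_mul]
        exact pow_le_pow_left₀ hT0.le hT2 e
      refine mul_le_mul (by linarith) h2 (by positivity) (by positivity)
    have h3 : 2 / c * (4 / a ^ N) ^ e * (T : ℝ) ^ e = 2 / (c * s ^ e) := by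
      rw [hs, mul_assoc, ← mul_pow, mul_one_div, div_mul_eq_mul_div, ← div_div, ← inv_div _ (a ^ N),
        inv_pow]
      field_simp
    rw [h3, div_le_iff₀ (by positivity)] at h1
    rw [div_lt_iff₀ hZ0]
    linarith
  set δ : ℝ := 1 / (8 * N * T) with hδ
  have hδ0 : 0 < δ := by positivity
  have hδ1 : δ ≤ 1 := by
    have : 1 ≤ (N : ℝ) * T := one_le_mul_of_one_le_of_one_le hN1 hT1
    rw [hδ, div_le_one (by positivity)]
    linarith
  have hE : (β : ℝ) * θ ^ L ≤ δ * a / 2 := by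
    have h1 : θ ^ L ≤ τ / T := by
      have h2 : θ ^ L ≤ τ ^ T := by
        rw [hL, pow_mul]
        exact pow_le_pow_left₀ (pow_nonneg hθ0 _) hθl T
      refine h2.trans ?_
      obtain ⟨t, rfl⟩ : ∃ t, T = t + 1 := ⟨T - 1, by omega⟩
      rw [pow_succ, le_div_iff₀ hT0]
      have h3 : τ ^ t ≤ (1 / 2) ^ t := pow_le_pow_left₀ hτ0.le hτ1 t
      have h4 : (((t + 1 : ℕ) : ℝ)) ≤ 2 ^ t := by exact_mod_cast Nat.lt_two_pow_self
      have h5 : τ ^ t * ((t + 1 : ℕ) : ℝ) ≤ 1 := by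
        refine (mul_le_mul h3 h4 (by positivity) (by positivity)).trans_eq ?_
        rw [← mul_pow]
        norm_num
      linarith [mul_le_mul_of_nonneg_right h5 hτ0.le]
    refine (mul_le_mul_of_nonneg_left h1 hβ0.le).trans_eq ?_
    rw [hτ, hδ]
    field_simp
    norm_num
  -- the construction
  set S : Fin N → MvPolynomial (Fin n) ℝ := fun i => geomInv (ψ (q i)) β L with hS
  set h : Fin N → MvPolynomial (Fin n) ℝ := fun i => ψ (p i) * S i - C δ with hh
  have hpt : ∀ z : Fin n → ℝ, (∀ i, z i ∈ Set.Icc (0 : ℝ) 1) →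
      (∀ j, -(1 / (Z : ℝ)) ≤ eval z (ψ (g j))) → ∀ i, a ≤ eval z (ψ (q i)) ∧
      δ * a / 2 ≤ eval z (ψ (p i)) - eval z (h i) * eval z (ψ (q i)) ∧
      eval z (ψ (p i)) / eval z (ψ (q i)) - 2 * δ ≤ eval z (h i) := by
    intro z hz hzη i
    have hqa := hqnear z hz (fun j => (neg_le_neg hZη₀).trans (hzη j)) i
    have hqb := (le_abs_self _).trans ((abs_eval_le_l1Norm (ψ (q i)) hz).trans (hβq i))
    obtain ⟨e, he0, heE, heq⟩ := exists_eval_geomInv_mul ha L hqa hqb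
    have := div_two_le_sub_mul ha hβ0.le ((abs_eval_le_l1Norm (ψ (p i)) hz).trans (hβp i)) hqa
      he0 heE hδ0.le hE heq
    simp only [hh, map_sub, map_mul, eval_C]
    exact ⟨hqa, this⟩
  have hlS : ∀ i, l1Norm (S i) ≤ Y := fun i => l1Norm_geomInv_le hβ1 (hβq i) L
  have hlh : ∀ i, l1Norm (h i) ≤ 2 * β * Y := fun i => by
    refine (l1Norm_sub_le _ _).trans ?_
    have h1 := (l1Norm_mul_le (ψ (p i)) (S i)).trans
      (mul_le_mul (hβp i) (hlS i) (l1Norm_nonneg _) hβ0.le)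
    have h2 := (l1Norm_C_le (n := n) δ).trans_eq (abs_of_pos hδ0)
    have h3 : 1 ≤ β * Y := one_le_mul_of_one_le_of_one_le hβ1 hY1
    linarith
  have hβL : β ≤ β * L := Nat.le_mul_of_pos_right β hL1
  have h2βL : 3 * β * L = 2 * β * L + β * L := by ring
  have hdh : ∀ i, (h i).totalDegree ≤ 2 * β * L := fun i => by
    refine (totalDegree_sub _ _).trans (max_le ((totalDegree_mul _ _).trans ?_) (by simp))
    have h1 := (hψdeg (p i)).trans (hdp i)
    have h2 := (totalDegree_geomInv_le (ψ (q i)) β L).trans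
      (Nat.mul_le_mul_left L ((hψdeg (q i)).trans (hdq i)))
    have h3 : (S i).totalDegree ≤ β * L := h2.trans_eq (mul_comm _ _)
    have h4 : 2 * β * L = β * L + β * L := by ring
    omega
  have hdegZ : 3 * β * L ≤ Z := by
    have h1 : ((3 * β * L : ℕ) : ℝ) ≤ Z := by
      refine le_trans ?_ hYZ
      push_cast
      have h2 : (β : ℝ) ≤ (β : ℝ) ^ 3 := le_self_pow₀ hβ1 (by norm_num)
      have h3 : (0 : ℝ) < β ^ 3 := by positivity
      calc 3 * (β : ℝ) * L ≤ 6 * (β : ℝ) ^ 3 * L := by gcongr; norm_num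
        _ ≤ 6 * (β : ℝ) ^ 3 * Y := by gcongr
    exact_mod_cast h1
  refine ⟨fun i => φ (h i), fun i _ => ?_, ?_, fun i _ => ?_⟩
  · refine (hφdeg _).trans ((hdh i).trans ?_)
    have h1 : Z < 2 ^ Z := Nat.lt_two_pow_self
    have h2 : 2 ^ Z ≤ 2 ^ Z ^ 10 :=
      Nat.pow_le_pow_right (by norm_num) (Nat.le_self_pow (by norm_num) Z)
    have h3 := max_le (hdq 0) (hdq i)
    omega
  · set U : MvPolynomial (Fin n) ℝ :=
      ψ (p 0) + ((∑ i ∈ Finset.univ.erase (0 : Fin N), h i) - C (ρ - 1 / T)) * ψ (q 0) with hU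
    have hφU : φ U = p 0 + ((∑ i ∈ Finset.univ.erase (0 : Fin N), φ (h i)) - C (ρ - 1 / T)) * q 0 := by
      rw [hU, map_add, map_mul, map_sub, map_sum, hφψ, hφψ, hφC]
    rw [← hφU]
    have hT' : 1 / (T : ℝ) ≤ 1 := by rw [div_le_one hT0]; exact hT1
    have hT'' : 0 < 1 / (T : ℝ) := by positivity
    refine hmem Z U hc₀Z ?_ ?_ ?_ k hk'
    · have h1 : l1Norm (∑ i ∈ Finset.univ.erase (0 : Fin N), h i) ≤ β * (2 * β * Y) := by
        refine (l1Norm_sum_le _ _).trans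
          ((Finset.sum_le_card_nsmul _ _ _ fun i _ => hlh i).trans ?_)
        rw [nsmul_eq_mul]
        refine mul_le_mul_of_nonneg_right (le_trans ?_ hβN) (by positivity)
        have := Finset.card_erase_le (s := (Finset.univ : Finset (Fin N))) (a := 0)
        rw [Finset.card_univ, Fintype.card_fin] at this
        exact_mod_cast this
      have h2 : l1Norm (C (ρ - 1 / T) : MvPolynomial (Fin n) ℝ) ≤ β := by
        refine (l1Norm_C_le _).trans ((abs_sub _ _).trans ?_)
        rw [abs_of_pos hT'']
        linarith
      have h3 := (l1Norm_mul_le _ (ψ (q 0))).trans (mul_le_mul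
        ((l1Norm_sub_le _ _).trans (add_le_add h1 h2)) (hβq 0) (l1Norm_nonneg _) (by positivity))
      refine (l1Norm_add_le _ _).trans ((add_le_add (hβp 0) h3).trans (le_trans ?_ hYZ))
      have h4 : (β : ℝ) ≤ (β : ℝ) ^ 3 := le_self_pow₀ hβ1 (by norm_num)
      have h5 : (β : ℝ) ^ 2 ≤ (β : ℝ) ^ 3 := pow_le_pow_right₀ hβ1 (by norm_num)
      have h6 : (β : ℝ) ^ 3 ≤ (β : ℝ) ^ 3 * Y := le_mul_of_one_le_right (by positivity) hY1
      linarith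
    · refine (totalDegree_add _ _).trans (max_le ((hψdeg _).trans ((hdp 0).trans ?_)) ?_)
      · omega
      · refine (totalDegree_mul _ _).trans ?_
        have h1 : (∑ i ∈ Finset.univ.erase (0 : Fin N), h i - C (ρ - 1 / T)).totalDegree ≤
            2 * β * L :=
          (totalDegree_sub _ _).trans (max_le (totalDegree_finsetSum_le fun i _ => hdh i)
            (by rw [totalDegree_C]; exact Nat.zero_le _))
        have h2 := (hψdeg (q 0)).trans (hdq 0)
        omega
    · intro z hz hzη
      have hall := hpt z hz hzη
      have hG := hGnear s hs0 hs1 _ hZs z hz hzη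
      simp only [← hψ, map_sub, map_sum, map_mul, map_prod, hψC, eval_C] at hG
      have hsum := neg_le_sum_div_sub (t := 1 / (4 * T)) ha (fun i => (hall i).1) hs.le
        (by positivity) hG
      have hsum2 : ∑ i ∈ Finset.univ.erase (0 : Fin N),
          (eval z (ψ (p i)) / eval z (ψ (q i)) - 2 * δ) ≤
          ∑ i ∈ Finset.univ.erase (0 : Fin N), eval z (h i) :=
        Finset.sum_le_sum fun i _ => (hall i).2.2
      rw [Finset.sum_sub_distrib, Finset.sum_const, nsmul_eq_mul] at hsum2
      rw [← Finset.add_sum_erase _ _ (Finset.mem_univ (0 : Fin N))] at hsum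
      have hcard : (((Finset.univ.erase (0 : Fin N)).card : ℕ) : ℝ) * (2 * δ) ≤ 1 / (4 * T) := by
        have h1 : (((Finset.univ.erase (0 : Fin N)).card : ℕ) : ℝ) ≤ N := by
          have := Finset.card_erase_le (s := (Finset.univ : Finset (Fin N))) (a := 0)
          rw [Finset.card_univ, Fintype.card_fin] at this
          exact_mod_cast this
        refine (mul_le_mul_of_nonneg_right h1 (by positivity)).trans_eq ?_
        rw [hδ]
        field_simp
        norm_num
      have hq0 : a ≤ eval z (ψ (q 0)) := (hall 0).1
      have hq0' : 0 < eval z (ψ (q 0)) := by linarith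
      have hUz : eval z U = (eval z (ψ (p 0)) / eval z (ψ (q 0)) +
          (∑ i ∈ Finset.univ.erase (0 : Fin N), eval z (h i) - (ρ - 1 / T))) *
          eval z (ψ (q 0)) := by
        rw [add_mul, div_mul_cancel₀ _ hq0'.ne', hU]
        simp only [map_add, map_mul, map_sub, map_sum, eval_C]
      have hquarter : 1 / (4 * (T : ℝ)) = 1 / 4 * (1 / T) := by field_simp
      have hbr : 1 / 2 * (1 / (T : ℝ)) ≤ eval z (ψ (p 0)) / eval z (ψ (q 0)) +
          (∑ i ∈ Finset.univ.erase (0 : Fin N), eval z (h i) - (ρ - 1 / T)) := by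
        rw [hquarter] at hsum hcard
        linarith
      rw [hUz]
      refine le_trans ?_ (mul_le_mul hbr hq0 ha.le (le_trans (by positivity) hbr))
      rw [div_le_iff₀ hZ0]
      have h1 : 2 * β * T ≤ (Z : ℝ) := by
        refine le_trans ?_ hTZ
        gcongr
        · norm_num
        · exact le_self_pow₀ hβ1 two_ne_zero
      have h2 : 1 ≤ a * β := by rwa [div_le_iff₀ ha, mul_comm] at hβa
      calc (1 : ℝ) ≤ a * β := h2
        _ = 1 / 2 * (1 / T) * a * (2 * β * T) := by field_simp
        _ ≤ 1 / 2 * (1 / T) * a * Z := by gcongr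
  · have hφV : φ (ψ (p i) - h i * ψ (q i)) = p i - φ (h i) * q i := by
      rw [map_sub, map_mul, hφψ, hφψ]
    rw [← hφV]
    refine hmem Z _ hc₀Z ?_ ?_ ?_ k hk'
    · have h1 := (l1Norm_mul_le (h i) (ψ (q i))).trans
        (mul_le_mul (hlh i) (hβq i) (l1Norm_nonneg _) (by positivity))
      refine (l1Norm_sub_le _ _).trans ((add_le_add (hβp i) h1).trans (le_trans ?_ hYZ))
      have h4 : (β : ℝ) ≤ (β : ℝ) ^ 3 := le_self_pow₀ hβ1 (by norm_num)
      have h5 : (β : ℝ) ^ 2 ≤ (β : ℝ) ^ 3 := pow_le_pow_right₀ hβ1 (by norm_num)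
      have h6 : (β : ℝ) ^ 3 ≤ (β : ℝ) ^ 3 * Y := le_mul_of_one_le_right (by positivity) hY1
      linarith [mul_le_mul_of_nonneg_right h5 (zero_le_one.trans hY1)]
    · refine (totalDegree_sub _ _).trans (max_le ((hψdeg _).trans ((hdp i).trans ?_)) ?_)
      · omega
      · refine (totalDegree_mul _ _).trans ?_
        have h1 := hdh i
        have h2 := (hψdeg (q i)).trans (hdq i)
        omega
    · intro z hz hzη
      rw [map_sub, map_mul]
      refine le_trans ?_ (hpt z hz hzη i).2.1
      rw [div_le_iff₀ hZ0]
      have h2 : 1 ≤ a * β := by rwa [div_le_iff₀ ha, mul_comm] at hβa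
      calc (1 : ℝ) ≤ a * β := h2
        _ = 1 / (8 * N * T) * a / 2 * (16 * β * N * T) := by field_simp; norm_num
        _ ≤ δ * a / 2 * Z := by
          rw [hδ]
          gcongr
          refine le_trans ?_ hTZ
          rw [sq]
          calc 16 * (β : ℝ) * N * T ≤ 16 * β * β * T := by gcongr
            _ = 16 * (β * β) * T := by ring

/-- A feasible value is a lower bound for `rhoRelax`: the feasible values are bounded above by the
objective at any point of the feasible set. -/
lemma le_rhoRelax_of_feasible {n m N : ℕ} [NeZero N] {g : Fin m → MvPolynomial (Fin n) ℝ}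
    {p q h : Fin N → MvPolynomial (Fin n) ℝ} {k : ℕ} {c : ℝ} {x : Fin n → ℝ}
    (hx : ∀ j, 0 ≤ eval x (g j)) (hq : ∀ i, 0 < eval x (q i))
    (hdeg : ∀ i : Fin N, i ≠ 0 →
      (h i).totalDegree ≤ 2 * k - max (q 0).totalDegree (q i).totalDegree)
    (hzero : (p 0 + ((∑ i ∈ Finset.univ.erase (0 : Fin N), h i) - C c) * q 0) ∈ QMod g k)
    (hne : ∀ i : Fin N, i ≠ 0 → (p i - h i * q i) ∈ QMod g k) :
    c ≤ rhoRelax g p q k := by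
  refine le_csSup ⟨∑ i, eval x (p i) / eval x (q i), ?_⟩ ⟨h, hdeg, hzero, hne⟩
  rintro b ⟨f, -, hb, hf⟩
  have hle : ∑ i ∈ Finset.univ.erase (0 : Fin N), eval x (f i) ≤
      ∑ i ∈ Finset.univ.erase (0 : Fin N), eval x (p i) / eval x (q i) := by
    refine Finset.sum_le_sum fun i hi => ?_
    have hi' := QMod.eval_nonneg (hf i (Finset.ne_of_mem_erase hi)) hx
    rw [le_div_iff₀ (hq i)]
    simpa using hi'
  have hb' := QMod.eval_nonneg hb hx
  simp only [map_add, map_mul, map_sub, map_sum, eval_C] at hb'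
  have hsplit := Finset.add_sum_erase Finset.univ
    (fun i => eval x (p i) / eval x (q i)) (Finset.mem_univ (0 : Fin N))
  have hbase : b - ∑ i ∈ Finset.univ.erase (0 : Fin N), eval x (f i) ≤
      eval x (p 0) / eval x (q 0) := by
    rw [le_div_iff₀ (hq 0)]
    linarith
  linarith

/-- Without variables the relaxation is exact at every order. -/
lemma rhoVal_le_rhoRelax_of_isEmpty {m N : ℕ} [NeZero N] {g : Fin m → MvPolynomial (Fin 0) ℝ}
    {p q : Fin N → MvPolynomial (Fin 0) ℝ} {K : Set (Fin 0 → ℝ)}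
    (hKdef : K = {x | ∀ j, 0 ≤ eval x (g j)}) (hq : ∀ i, ∀ x ∈ K, 0 < eval x (q i))
    (h0 : 0 ∈ K) (k : ℕ) : rhoVal K p q ≤ rhoRelax g p q k := by
  have hρ : rhoVal K p q = ∑ i, eval 0 (p i) / eval 0 (q i) := by
    have hset : {v : ℝ | ∃ x ∈ K, v = ∑ i, eval x (p i) / eval x (q i)} =
        {∑ i, eval 0 (p i) / eval 0 (q i)} := by
      ext v
      constructor
      · rintro ⟨x, -, rfl⟩
        rw [Subsingleton.elim x 0]
        rfl
      · rintro rfl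
        exact ⟨0, h0, rfl⟩
    rw [rhoVal, hset, csInf_singleton]
  have hext : ∀ f : MvPolynomial (Fin 0) ℝ, eval 0 f = 0 → f = 0 := by
    intro f hf
    rw [eq_C_of_isEmpty f] at hf ⊢
    simp only [eval_C] at hf
    rw [hf, C_0]
  have hsplit := Finset.add_sum_erase Finset.univ
    (fun i => eval 0 (p i) / eval 0 (q i)) (Finset.mem_univ (0 : Fin N))
  have hq0 : ∀ i, eval 0 (q i) ≠ 0 := fun i => (hq i 0 h0).ne'
  refine le_rhoRelax_of_feasible (x := 0) (h := fun i => C (eval 0 (p i) / eval 0 (q i)))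
    (by rw [hKdef] at h0; exact h0) (fun i => hq i 0 h0) (fun i _ => by simp) ?_ ?_
  · rw [hext (p 0 + _)]
    · exact QMod.zero_mem k
    · simp only [map_add, map_mul, map_sub, map_sum, eval_C]
      rw [hρ, ← hsplit]
      have := hq0 0
      field_simp
      ring
  · intro i _
    rw [hext (p i - _)]
    · exact QMod.zero_mem k
    · have := hq0 i
      simp only [map_mul, map_sub, eval_C]
      field_simp
      ring

lemma exists_pos_le_eval {n N : ℕ} {q : Fin N → MvPolynomial (Fin n) ℝ}
    {K : Set (Fin n → ℝ)} (hK : IsCompact K) (hq : ∀ i, ∀ x ∈ K, 0 < eval x (q i)) :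
    ∃ a : ℝ, 0 < a ∧ a ≤ 1 ∧ ∀ x ∈ K, ∀ i, 2 * a ≤ eval x (q i) := by
  have hone : ∀ i, ∃ b : ℝ, 0 < b ∧ ∀ x ∈ K, b ≤ eval x (q i) := by
    intro i
    rcases K.eq_empty_or_nonempty with rfl | hne
    · exact ⟨1, one_pos, by simp⟩
    · obtain ⟨z, hz, hmin⟩ := hK.exists_isMinOn hne (MvPolynomial.continuous_eval (q i)).continuousOn
      exact ⟨_, hq i z hz, fun x hx => hmin hx⟩
  choose b hb hbq using hone
  obtain ⟨c, hc, hcb⟩ : ∃ c : ℝ, 0 < c ∧ ∀ i, c ≤ b i := by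
    rcases isEmpty_or_nonempty (Fin N) with _ | _
    · exact ⟨1, one_pos, fun i => isEmptyElim i⟩
    · obtain ⟨i, hi⟩ := Finite.exists_min b
      exact ⟨b i, hb i, hi⟩
  refine ⟨min 1 (c / 2), by positivity, min_le_left _ _, fun x hx i => ?_⟩
  have := min_le_right 1 (c / 2)
  linarith [hcb i, hbq i x hx]

lemma isCompact_objective_values {n N : ℕ} {p q : Fin N → MvPolynomial (Fin n) ℝ}
    {K : Set (Fin n → ℝ)} (hK : IsCompact K) (hq : ∀ i, ∀ x ∈ K, 0 < eval x (q i)) :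
    IsCompact {v : ℝ | ∃ x ∈ K, v = ∑ i, eval x (p i) / eval x (q i)} := by
  have himage : {v : ℝ | ∃ x ∈ K, v = ∑ i, eval x (p i) / eval x (q i)} =
      (fun x => ∑ i, eval x (p i) / eval x (q i)) '' K := by
    ext v
    simp only [Set.mem_ofPred_eq, Set.mem_image, eq_comm]
  rw [himage]
  refine hK.image_of_continuousOn (continuousOn_finsetSum _ fun i _ => ?_)
  exact (MvPolynomial.continuous_eval _).continuousOn.div
    (MvPolynomial.continuous_eval _).continuousOn fun x hx => (hq i x hx).ne'

lemma isCompact_denominator_values {n N : ℕ} [NeZero N] {q : Fin N → MvPolynomial (Fin n) ℝ}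
    {K : Set (Fin n → ℝ)} (hK : IsCompact K) :
    IsCompact {v : ℝ | ∃ i : Fin N, i ≠ 0 ∧ ∃ x ∈ K, v = eval x (q i)} := by
  have hunion : {v : ℝ | ∃ i : Fin N, i ≠ 0 ∧ ∃ x ∈ K, v = eval x (q i)} =
      ⋃ i ∈ {i : Fin N | i ≠ 0}, (fun x => eval x (q i)) '' K := by
    ext v
    simp only [Set.mem_ofPred_eq, Set.mem_iUnion, Set.mem_image, exists_prop, eq_comm]
  rw [hunion]
  exact (Set.toFinite _).isCompact_biUnion fun i _ =>
    hK.image (MvPolynomial.continuous_eval _)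

lemma one_le_qMaxVal_div_qMinVal {n N : ℕ} [NeZero N] (hN : 2 ≤ N)
    {q : Fin N → MvPolynomial (Fin n) ℝ} {K : Set (Fin n → ℝ)} (hK : IsCompact K)
    (hne : K.Nonempty) (hq : ∀ i, ∀ x ∈ K, 0 < eval x (q i)) :
    1 ≤ qMaxVal K q / qMinVal K q := by
  obtain ⟨x, hx⟩ := hne
  have hcompact := isCompact_denominator_values (q := q) hK
  have hvals : {v : ℝ | ∃ i : Fin N, i ≠ 0 ∧ ∃ x ∈ K, v = eval x (q i)}.Nonempty := by
    refine ⟨_, ⟨1, hN⟩, fun h => ?_, x, hx, rfl⟩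
    simp [Fin.ext_iff] at h
  have hpos : 0 < qMinVal K q := by
    obtain ⟨i, -, y, hy, hv⟩ := hcompact.sInf_mem hvals
    rw [qMinVal, hv]
    exact hq i y hy
  rw [le_div_iff₀ hpos, one_mul]
  exact csInf_le_csSup hvals hcompact.bddBelow hcompact.bddAbove

lemma ceil_le_DBound {n N : ℕ} [NeZero N] (p q : Fin N → MvPolynomial (Fin n) ℝ) (C₁ ε : ℝ) :
    ⌈4 * C₁ * ((N : ℝ) - 1) / ε⌉₊ ≤ DBound p q C₁ ε :=
  ((Nat.le_add_right _ _).trans (le_max_right _ _)).trans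
    (Finset.le_sup (f := fun i : Fin N => max (p i).totalDegree
      (⌈4 * C₁ * ((N : ℝ) - 1) / ε⌉₊ + (q i).totalDegree)) (Finset.mem_univ 0))

/-- Convergence rate of the hierarchy `(Dk)`: under the Archimedean
condition and `0 ∈ int K`, there exist constants `C₁, C₂ > 0` such that for every `ε > 0`,
`ρ_k ≥ ρ − ε` whenever
`k ≥ C₂·exp[(3(3ωn)^{D(N,ε)} D(N,ε)² ((4(ρ^max − ρ)+3ε)(N−1)/ε)(q^max/q^min))^{C₂}]`. -/
theorem stmt_5 (n m N : ℕ) [NeZero N] (hN : 2 ≤ N)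
    (g : Fin m → MvPolynomial (Fin n) ℝ) (p q : Fin N → MvPolynomial (Fin n) ℝ)
    (K : Set (Fin n → ℝ)) (hKdef : K = {x | ∀ j, 0 ≤ eval x (g j)})
    (hK : IsCompact K) (hq : ∀ i, ∀ x ∈ K, 0 < eval x (q i))
    (hArch : IsArchimedeanQM g) (h0 : (0 : Fin n → ℝ) ∈ interior K) :
    ∃ C₁ : ℝ, 0 < C₁ ∧ ∃ C₂ : ℝ, 0 < C₂ ∧ ∀ ε : ℝ, 0 < ε → ∀ k : ℕ,
      C₂ * Real.exp ((3 * (3 * max 1 (kappaVal K) * (n : ℝ)) ^ DBound p q C₁ ε *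
          (DBound p q C₁ ε : ℝ) ^ 2 *
          ((4 * (rhoMaxVal K p q - rhoVal K p q) + 3 * ε) * ((N : ℝ) - 1) / ε) *
          (qMaxVal K q / qMinVal K q)) ^ C₂) ≤ (k : ℝ) →
      rhoVal K p q - ε ≤ rhoRelax g p q k := by
  have h0K : (0 : Fin n → ℝ) ∈ K := interior_subset h0
  refine ⟨1, one_pos, ?_⟩
  rcases Nat.eq_zero_or_pos n with rfl | hn
  · exact ⟨1, one_pos, fun ε hε k _ =>
      (sub_le_self _ hε.le).trans (rhoVal_le_rhoRelax_of_isEmpty hKdef hq h0K k)⟩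
  have hcompact := isCompact_objective_values (p := p) hK hq
  have hmem : ∀ x, (∀ j, 0 ≤ eval x (g j)) → x ∈ K := fun x hx => by rw [hKdef]; exact hx
  obtain ⟨a, ha, ha1, haq⟩ := exists_pos_le_eval hK hq
  obtain ⟨W, hW⟩ := exists_feasible (ρ := rhoVal K p q) g p q hArch ha ha1
    (fun x hx => haq x (hmem x hx))
    (fun x hx => csInf_le hcompact.bddBelow ⟨x, hmem x hx, rfl⟩)
  refine ⟨((W + 1 : ℕ) : ℝ), by positivity, fun ε hε k hk => ?_⟩
  have hT : 1 ≤ ⌈1 / ε⌉₊ := Nat.one_le_iff_ne_zero.2 (Nat.ceil_pos.2 (by positivity)).ne'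
  set T := ⌈1 / ε⌉₊ with hTdef
  have hTε : 1 / (T : ℝ) ≤ ε := by
    have hle : 1 / ε ≤ T := Nat.le_ceil _
    rw [div_le_iff₀ hε] at hle
    rw [div_le_iff₀ (by exact_mod_cast hT)]
    linarith
  have hN1 : (1 : ℝ) ≤ (N : ℝ) - 1 := by
    have : (2 : ℝ) ≤ N := by exact_mod_cast hN
    linarith
  have hTD : T ≤ DBound p q 1 ε := by
    refine (Nat.ceil_mono ?_).trans (ceil_le_DBound p q 1 ε)
    gcongr
    linarith
  have hρ : rhoVal K p q ≤ rhoMaxVal K p q :=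
    csInf_le_csSup ⟨_, 0, h0K, rfl⟩ hcompact.bddBelow hcompact.bddAbove
  have hpow : (3 : ℝ) ^ T ≤ (3 * max 1 (kappaVal K) * (n : ℝ)) ^ DBound p q 1 ε := by
    have hbase : (3 : ℝ) ≤ 3 * max 1 (kappaVal K) * (n : ℝ) := by
      have hω : (1 : ℝ) ≤ max 1 (kappaVal K) := le_max_left _ _
      have hn1 : (1 : ℝ) ≤ n := by exact_mod_cast hn
      nlinarith
    calc (3 : ℝ) ^ T ≤ 3 ^ DBound p q 1 ε := pow_le_pow_right₀ (by norm_num) hTD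
      _ ≤ _ := pow_le_pow_left₀ (by norm_num) hbase _
  have hD : (1 : ℝ) ≤ (DBound p q 1 ε : ℝ) ^ 2 :=
    one_le_pow₀ (by exact_mod_cast hT.trans hTD)
  have hgap : 1 ≤ (4 * (rhoMaxVal K p q - rhoVal K p q) + 3 * ε) * ((N : ℝ) - 1) / ε := by
    rw [le_div_iff₀ hε]
    nlinarith
  have hquot := one_le_qMaxVal_div_qMinVal hN hK ⟨0, h0K⟩ hq
  set B := 3 * (3 * max 1 (kappaVal K) * (n : ℝ)) ^ DBound p q 1 ε *
    (DBound p q 1 ε : ℝ) ^ 2 *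
    ((4 * (rhoMaxVal K p q - rhoVal K p q) + 3 * ε) * ((N : ℝ) - 1) / ε) *
    (qMaxVal K q / qMinVal K q) with hB
  have hBT : (3 : ℝ) ^ T ≤ B := by
    have h3 : (0 : ℝ) < 3 ^ T := by positivity
    calc (3 : ℝ) ^ T = 1 * 3 ^ T * 1 * 1 * 1 := by ring
      _ ≤ B := by rw [hB]; gcongr; norm_num
  have hWB : ((W ^ T : ℕ) : ℝ) ≤ B ^ (W + 1) := by
    have hW3 : (W : ℝ) ≤ 3 ^ (W + 1) := by
      exact_mod_cast (Nat.lt_pow_self (by norm_num : 1 < 3)).le.trans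
        (Nat.pow_le_pow_right (by norm_num) W.le_succ)
    calc ((W ^ T : ℕ) : ℝ) = (W : ℝ) ^ T := by push_cast; rfl
      _ ≤ (3 ^ (W + 1)) ^ T := pow_le_pow_left₀ (by positivity) hW3 _
      _ = (3 ^ T) ^ (W + 1) := by rw [← pow_mul, ← pow_mul, mul_comm]
      _ ≤ B ^ (W + 1) := pow_le_pow_left₀ (by positivity) hBT _
  have hk' : 2 ^ W ^ T ≤ k := by
    have hreal : (2 : ℝ) ^ W ^ T ≤ k := by
      refine le_trans ?_ hk
      rw [Real.rpow_natCast]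
      calc (2 : ℝ) ^ W ^ T ≤ Real.exp 1 ^ W ^ T :=
            pow_le_pow_left₀ (by norm_num) (by linarith [Real.add_one_le_exp 1]) _
        _ = Real.exp ((W ^ T : ℕ) : ℝ) := by rw [← Real.exp_nat_mul, mul_one]
        _ ≤ 1 * Real.exp (B ^ (W + 1)) := by rw [one_mul]; exact Real.exp_le_exp.2 hWB
        _ ≤ _ := by
            gcongr
            exact_mod_cast Nat.succ_le_succ W.zero_le
    exact_mod_cast hreal
  obtain ⟨h, hdeg, hzero, hne⟩ := hW T hT k hk'
  have hfeas := le_rhoRelax_of_feasible (x := 0) (by rw [hKdef] at h0K; exact h0K)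
    (fun i => hq i 0 h0K) hdeg hzero hne
  linarith
end
end

section
/- Let f ∈ ℝ[x_1,…,x_n] and A = supp(f) ∪ ∪_{j=1}^m supp(g_j). If f ∈ Q_k(g), then f ∈ Q_k(g, A), i.e., any order-k Putinar representation of f can be replaced by one whose Gram matrices obey the sign-symmetry sparsity pattern of A. -/
open MvPolynomial

noncomputable section

/-- Parity pairing `r·α = ∑ᵢ rᵢ αᵢ` between `r ∈ {0,1}ⁿ` and an exponent vector `α`. -/
def dotPar {n : ℕ} (r : Fin n → Fin 2) (α : Fin n →₀ ℕ) : ℕ :=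
  ∑ i, (r i : ℕ) * α i

/-- Sign symmetries `R(A) = {r ∈ {0,1}ⁿ : r·α ≡ 0 (mod 2) ∀ α ∈ A}`. -/
def signSyms {n : ℕ} (A : Finset (Fin n →₀ ℕ)) : Finset (Fin n → Fin 2) :=
  Finset.univ.filter fun r => ∀ α ∈ A, 2 ∣ dotPar r α

/-- `Ā = {α ∈ ℕⁿ : r·α ≡ 0 (mod 2) ∀ r ∈ R(A)}`. -/
def symClosure {n : ℕ} (A : Finset (Fin n →₀ ℕ)) : Set (Fin n →₀ ℕ) :=
  {α | ∀ r ∈ signSyms A, 2 ∣ dotPar r α}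

/-- The (finite) set of exponent vectors of total degree at most `s`:
the index set of the monomial vector `[x]_s`. -/
def monosUpTo (n s : ℕ) : Finset (Fin n →₀ ℕ) :=
  (Finset.Iic (Finsupp.equivFunOnFinite.symm fun _ : Fin n => s)).filter
    fun α => (α.sum fun _ e => e) ≤ s

/-- `G` is a positive semidefinite symmetric matrix indexed by the monomials of degree
`≤ s`, whose entries vanish at positions `(α,β)` with `α + β ∉ Abar`. -/
def IsPSDGram {n : ℕ} (s : ℕ) (Abar : Set (Fin n →₀ ℕ))
    (G : (Fin n →₀ ℕ) → (Fin n →₀ ℕ) → ℝ) : Prop :=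
  (∀ α β, G α β = G β α) ∧
  (∀ α β, α + β ∉ Abar → G α β = 0) ∧
  (∀ v : (Fin n →₀ ℕ) → ℝ,
    0 ≤ ∑ α ∈ monosUpTo n s, ∑ β ∈ monosUpTo n s, v α * G α β * v β)

/-- The polynomial `[x]_sᵀ G [x]_s`. -/
def gramPoly {n : ℕ} (s : ℕ) (G : (Fin n →₀ ℕ) → (Fin n →₀ ℕ) → ℝ) :
    MvPolynomial (Fin n) ℝ :=
  ∑ α ∈ monosUpTo n s, ∑ β ∈ monosUpTo n s,
    G α β • (monomial (α + β) (1 : ℝ))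

/-- The sparse truncated quadratic module `Q_k(g, A)`: polynomials
`σ₀ + ∑_j σ_j g_j` where `σ_j = [x]_{k−d_j}ᵀ G_j [x]_{k−d_j}` for PSD symmetric matrices
`G_j` obeying the sign-symmetry sparsity pattern of `A` (here `d_0 = 0`,
`d_j = ⌈deg g_j / 2⌉`). -/
def QModSparse {n m : ℕ} (g : Fin m → MvPolynomial (Fin n) ℝ)
    (A : Finset (Fin n →₀ ℕ)) (k : ℕ) : Set (MvPolynomial (Fin n) ℝ) :=
  {f | ∃ (G₀ : (Fin n →₀ ℕ) → (Fin n →₀ ℕ) → ℝ)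
        (G : Fin m → (Fin n →₀ ℕ) → (Fin n →₀ ℕ) → ℝ),
    IsPSDGram k (symClosure A) G₀ ∧
    (∀ j, IsPSDGram (k - ((g j).totalDegree + 1) / 2) (symClosure A) (G j)) ∧
    f = gramPoly k G₀ +
      ∑ j, gramPoly (k - ((g j).totalDegree + 1) / 2) (G j) * g j}

/-- Over the reals leading terms of squares cannot cancel, so the summands of a sum of squares
have at most half its degree. -/
theorem totalDegree_le_of_sum_sq {n t s : ℕ} (p : Fin t → MvPolynomial (Fin n) ℝ)
    (h : (∑ i, p i ^ 2).totalDegree ≤ 2 * s + 1) (i : Fin t) : (p i).totalDegree ≤ s := by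
  obtain ⟨j, -, hj⟩ := Finset.exists_max_image Finset.univ
    (fun i => MonomialOrder.degLex.toSyn (MonomialOrder.degLex.degree (p i)))
    ⟨i, Finset.mem_univ i⟩
  have hij : (p i).totalDegree ≤ (p j).totalDegree :=
    degLex_totalDegree_monotone (hj i (Finset.mem_univ i))
  by_cases hpj : p j = 0
  · simp [hpj] at hij
    omega
  set a := MonomialOrder.degLex.degree (p j)
  have hcoeff : coeff (a + a) (∑ i, p i ^ 2) = ∑ i, coeff a (p i) ^ 2 := by
    rw [coeff_sum]
    refine Finset.sum_congr rfl fun l _ => ?_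
    rw [sq, sq]
    exact MonomialOrder.coeff_mul_of_add_of_degree_le (hj l (Finset.mem_univ l))
      (hj l (Finset.mem_univ l))
  have hpos : 0 < coeff (a + a) (∑ i, p i ^ 2) := by
    rw [hcoeff]
    refine Finset.sum_pos' (fun l _ => sq_nonneg _) ⟨j, Finset.mem_univ j, ?_⟩
    have : coeff a (p j) ≠ 0 := mem_support_iff.1 (MonomialOrder.degLex.degree_mem_support hpj)
    positivity
  have hle := le_totalDegree (mem_support_iff.2 hpos.ne')
  have hdeg : a.degree = (p j).totalDegree := degree_degLexDegree
  have hadd : ((a + a).sum fun _ e => e) = a.degree + a.degree := map_add Finsupp.degree a a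
  omega

theorem mem_monosUpTo {n s : ℕ} {α : Fin n →₀ ℕ} :
    α ∈ monosUpTo n s ↔ (α.sum fun _ e => e) ≤ s := by
  simp only [monosUpTo, Finset.mem_filter, Finset.mem_Iic, and_iff_right_iff_imp]
  intro h i
  exact (Finsupp.le_degree i α).trans h

theorem eq_sum_monosUpTo {n s : ℕ} {p : MvPolynomial (Fin n) ℝ} (hp : p.totalDegree ≤ s) :
    p = ∑ α ∈ monosUpTo n s, monomial α (coeff α p) := by
  conv_lhs => rw [p.as_sum]
  refine Finset.sum_subset (fun α hα => mem_monosUpTo.2 ((le_totalDegree hα).trans hp)) ?_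
  intro α _ hα
  rw [notMem_support_iff.1 hα, monomial_zero]

theorem dotPar_add {n : ℕ} (r : Fin n → Fin 2) (α β : Fin n →₀ ℕ) :
    dotPar r (α + β) = dotPar r α + dotPar r β := by
  simp [dotPar, mul_add, Finset.sum_add_distrib]

theorem subset_symClosure {n : ℕ} (A : Finset (Fin n →₀ ℕ)) : (A : Set _) ⊆ symClosure A :=
  fun _ hα _ hr => (Finset.mem_filter.1 hr).2 _ hα

theorem add_mem_symClosure_iff {n : ℕ} {A : Finset (Fin n →₀ ℕ)} {α β : Fin n →₀ ℕ}
    (hβ : β ∈ symClosure A) : α + β ∈ symClosure A ↔ α ∈ symClosure A :=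
  forall₂_congr fun r hr => by rw [dotPar_add, Nat.dvd_add_left (hβ r hr)]

/-- The parities of `r·α` for the sign symmetries `r` of `A`. -/
def signature {n : ℕ} (A : Finset (Fin n →₀ ℕ)) (α : Fin n →₀ ℕ) : signSyms A → ZMod 2 :=
  fun r => dotPar r.1 α

theorem add_mem_symClosure_iff_signature_eq {n : ℕ} {A : Finset (Fin n →₀ ℕ)}
    {α β : Fin n →₀ ℕ} : α + β ∈ symClosure A ↔ signature A α = signature A β := by
  simp only [symClosure, Set.mem_ofPred_eq, funext_iff, Subtype.forall, signature]
  refine forall₂_congr fun r _ => ?_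
  rw [dotPar_add, ZMod.natCast_eq_natCast_iff']
  omega

open Classical in
/-- The projection of polynomials onto the span of the monomials with exponent in `S`. -/
def supportProj {n : ℕ} (S : Set (Fin n →₀ ℕ)) :
    MvPolynomial (Fin n) ℝ →ₗ[ℝ] MvPolynomial (Fin n) ℝ :=
  (basisMonomials (Fin n) ℝ).constr ℝ fun α => if α ∈ S then monomial α 1 else 0

open Classical in
theorem supportProj_monomial {n : ℕ} (S : Set (Fin n →₀ ℕ)) (α : Fin n →₀ ℕ) (c : ℝ) :
    supportProj S (monomial α c) = if α ∈ S then monomial α c else 0 := by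
  have h1 : supportProj S (monomial α 1) = if α ∈ S then monomial α 1 else 0 := by
    have := (basisMonomials (Fin n) ℝ).constr_basis ℝ
      (fun α => if α ∈ S then monomial α (1 : ℝ) else 0) α
    rwa [coe_basisMonomials] at this
  have hc : monomial α c = c • monomial α (1 : ℝ) := by simp [smul_monomial]
  rw [hc, map_smul, h1, smul_ite, smul_zero]

theorem supportProj_eq_self {n : ℕ} {S : Set (Fin n →₀ ℕ)} {p : MvPolynomial (Fin n) ℝ}
    (hp : (p.support : Set _) ⊆ S) : supportProj S p = p := by
  conv_lhs => rw [p.as_sum]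
  conv_rhs => rw [p.as_sum]
  rw [map_sum]
  exact Finset.sum_congr rfl fun α hα => by rw [supportProj_monomial, if_pos (hp hα)]

theorem supportProj_symClosure_mul {n : ℕ} {A : Finset (Fin n →₀ ℕ)}
    (q : MvPolynomial (Fin n) ℝ) {p : MvPolynomial (Fin n) ℝ}
    (hp : (p.support : Set _) ⊆ symClosure A) :
    supportProj (symClosure A) (q * p) = supportProj (symClosure A) q * p := by
  induction q using MvPolynomial.induction_on' with
  | monomial α c =>
    rw [p.as_sum, Finset.mul_sum, Finset.mul_sum, map_sum]
    refine Finset.sum_congr rfl fun β hβ => ?_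
    rw [monomial_mul, supportProj_monomial, supportProj_monomial]
    have hα : α + β ∈ symClosure A ↔ α ∈ symClosure A := add_mem_symClosure_iff (hp hβ)
    by_cases h : α ∈ symClosure A
    · rw [if_pos h, if_pos (hα.2 h), monomial_mul]
    · rw [if_neg h, if_neg (mt hα.1 h), zero_mul]
  | add q₁ q₂ h₁ h₂ => rw [add_mul, map_add, map_add, add_mul, h₁, h₂]

open Classical in
/-- The Gram matrix of `∑ i, p i ^ 2`, with the entries at positions `(α, β)` such that
`α + β ∉ symClosure A` removed. -/
def sparseGram {n t : ℕ} (A : Finset (Fin n →₀ ℕ)) (p : Fin t → MvPolynomial (Fin n) ℝ)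
    (α β : Fin n →₀ ℕ) : ℝ :=
  if α + β ∈ symClosure A then ∑ i, coeff α (p i) * coeff β (p i) else 0

theorem sum_sum_ite_eq_nonneg {ι κ : Type*} [Fintype κ] [DecidableEq κ] (s : Finset ι)
    (c : ι → κ) (w : ι → ℝ) :
    0 ≤ ∑ a ∈ s, ∑ b ∈ s, if c a = c b then w a * w b else 0 := by
  have h : ∑ a ∈ s, ∑ b ∈ s, (if c a = c b then w a * w b else 0) =
      ∑ x : κ, (∑ a ∈ s, if c a = x then w a else 0) ^ 2 := by
    simp_rw [sq, Finset.sum_mul_sum]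
    rw [Finset.sum_comm (s := Finset.univ)]
    refine Finset.sum_congr rfl fun a _ => ?_
    rw [Finset.sum_comm (s := Finset.univ)]
    refine Finset.sum_congr rfl fun b _ => ?_
    simp [eq_comm]
  rw [h]
  positivity

theorem isPSDGram_sparseGram {n t : ℕ} (s : ℕ) (A : Finset (Fin n →₀ ℕ))
    (p : Fin t → MvPolynomial (Fin n) ℝ) :
    IsPSDGram s (symClosure A) (sparseGram A p) := by
  classical
  refine ⟨fun α β => ?_, fun α β h => if_neg h, fun v => ?_⟩
  · simp only [sparseGram, add_comm α β, mul_comm (coeff α _)]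
  · have h : ∑ α ∈ monosUpTo n s, ∑ β ∈ monosUpTo n s, v α * sparseGram A p α β * v β =
        ∑ i, ∑ α ∈ monosUpTo n s, ∑ β ∈ monosUpTo n s,
          if signature A α = signature A β then
            (v α * coeff α (p i)) * (v β * coeff β (p i)) else 0 := by
      rw [Finset.sum_comm (s := Finset.univ)]
      refine Finset.sum_congr rfl fun α _ => ?_
      rw [Finset.sum_comm (s := Finset.univ)]
      refine Finset.sum_congr rfl fun β _ => ?_
      simp only [sparseGram, add_mem_symClosure_iff_signature_eq]
      split_ifs
      · rw [Finset.mul_sum, Finset.sum_mul]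
        exact Finset.sum_congr rfl fun i _ => by ring
      · simp
    rw [h]
    exact Finset.sum_nonneg fun i _ => sum_sum_ite_eq_nonneg _ _ _

theorem gramPoly_sparseGram {n t s : ℕ} (A : Finset (Fin n →₀ ℕ))
    (p : Fin t → MvPolynomial (Fin n) ℝ) (hp : ∀ i, (p i).totalDegree ≤ s) :
    gramPoly s (sparseGram A p) = supportProj (symClosure A) (∑ i, p i ^ 2) := by
  have h : ∑ i, p i ^ 2 = ∑ α ∈ monosUpTo n s, ∑ β ∈ monosUpTo n s,
      monomial (α + β) (∑ i, coeff α (p i) * coeff β (p i)) := by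
    simp_rw [map_sum]
    rw [Finset.sum_congr rfl fun i _ => by
      rw [eq_sum_monosUpTo (hp i), sq, Finset.sum_mul_sum], Finset.sum_comm]
    refine Finset.sum_congr rfl fun α _ => ?_
    rw [Finset.sum_comm]
    simp_rw [monomial_mul]
  simp_rw [h, map_sum, supportProj_monomial, gramPoly, sparseGram, smul_monomial, smul_eq_mul,
    mul_one]
  refine Finset.sum_congr rfl fun α _ => Finset.sum_congr rfl fun β _ => ?_
  split_ifs <;> simp

theorem exists_isPSDGram_mul_eq {n k : ℕ} (A : Finset (Fin n →₀ ℕ))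
    {σ g : MvPolynomial (Fin n) ℝ} (hσ : IsSOSPoly σ) (hdeg : (σ * g).totalDegree ≤ 2 * k)
    (hg : (g.support : Set _) ⊆ symClosure A) :
    ∃ G, IsPSDGram (k - (g.totalDegree + 1) / 2) (symClosure A) G ∧
      gramPoly (k - (g.totalDegree + 1) / 2) G * g = supportProj (symClosure A) (σ * g) := by
  obtain ⟨t, p, rfl⟩ := hσ
  by_cases h0 : (∑ i, p i ^ 2) * g = 0
  · refine ⟨0, by simp [IsPSDGram], ?_⟩
    rw [h0]
    simp [gramPoly]
  · rw [totalDegree_mul_of_isDomain (left_ne_zero_of_mul h0) (right_ne_zero_of_mul h0)] at hdeg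
    refine ⟨sparseGram A p, isPSDGram_sparseGram _ A p, ?_⟩
    rw [supportProj_symClosure_mul _ hg, gramPoly_sparseGram A p]
    exact totalDegree_le_of_sum_sq p (by omega)

/-- If `f ∈ Q_k(g)` then `f ∈ Q_k(g, A)` where
`A = supp(f) ∪ ⋃_j supp(g_j)`. -/
theorem stmt_12 (n m : ℕ) (g : Fin m → MvPolynomial (Fin n) ℝ)
    (f : MvPolynomial (Fin n) ℝ) (k : ℕ) (hf : f ∈ QMod g k) :
    f ∈ QModSparse g (f.support ∪ Finset.univ.biUnion fun j => (g j).support) k := by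
  obtain ⟨σ₀, σ, ⟨t, p, rfl⟩, hσ, hdeg₀, hdeg, hsum⟩ := hf
  set A := f.support ∪ Finset.univ.biUnion fun j => (g j).support
  have hfA : (f.support : Set _) ⊆ symClosure A := fun α hα =>
    subset_symClosure A (Finset.mem_union_left _ hα)
  have hgA (j) : ((g j).support : Set _) ⊆ symClosure A := fun α hα =>
    subset_symClosure A (Finset.mem_union_right _
      (Finset.mem_biUnion.2 ⟨j, Finset.mem_univ j, hα⟩))
  choose G hG hGeq using fun j => exists_isPSDGram_mul_eq A (hσ j) (hdeg j) (hgA j)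
  refine ⟨sparseGram A p, G, isPSDGram_sparseGram _ A p, hG, ?_⟩
  rw [gramPoly_sparseGram A p (totalDegree_le_of_sum_sq p (by omega)), Finset.sum_congr rfl
    fun j _ => hGeq j, ← map_sum, ← map_add, ← hsum, supportProj_eq_self hfA]
end
end
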